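/- arXiv:2105.06201 — 3 statements merged into one kernel-verified Lean document; each statement's English description precedes it below -/
import Mathlib

section
/- For all rates (R1,R2) ∈ (0,∞)², the set Q_{02}(R1,R2) = {Q_{W1W2|U} : R2 > I(U;W2) and R1+R2 > I(U;W1,W2)} is nonempty, open, and dense in Q0(R1,R2) = {Q_{W1W2|U} : R2 ≥ I(U;W2) and R1+R2 ≥ I(U;W1,W2)}. -/
open scoped BigOperators

namespace Persuasion

/-- `p` is a probability distribution on the finite alphabet `α`. -/
def IsDist {α : Type*} [Fintype α] (p : α → ℝ) : Prop :=
  (∀ a, 0 ≤ p a) ∧ ∑ a, p a = 1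

/-- `k` is a stochastic map (transition kernel) from `α` to `β`. -/
def IsKernel {α : Type*} {β : Type*} [Fintype β] (k : α → β → ℝ) : Prop :=
  ∀ a, IsDist (k a)

/-- Shannon entropy (in bits) of a distribution on a finite alphabet. -/
noncomputable def ent {α : Type*} [Fintype α] (p : α → ℝ) : ℝ :=
  - ∑ a, p a * Real.logb 2 (p a)

/-- Mutual information (in bits) computed from a joint distribution on `α × β`. -/
noncomputable def miOfJoint {α β : Type*} [Fintype α] [Fintype β] (p : α × β → ℝ) : ℝ :=
  ent (fun a => ∑ b, p (a, b)) + ent (fun b => ∑ a, p (a, b)) - ent p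

/-- Message alphabet `{1, …, 2^⌊n·R⌋}` at rate `R` and blocklength `n`. -/
abbrev Msg (R : ℝ) (n : ℕ) : Type := Fin (2 ^ ⌊(n : ℝ) * R⌋₊)

section Operational

variable {U V1 V2 M1 M2 : Type*} [Fintype U] [Fintype V1] [Fintype V2]
  [Fintype M1] [Fintype M2]

/-- Long-run encoder distortion `d_e^n(σ,τ1,τ2)`. -/
noncomputable def deN (PU : U → ℝ) (de : U → V1 → V2 → ℝ) {n : ℕ}
    (σ : (Fin n → U) → M1 × M2 → ℝ)
    (τ1 : M1 × M2 → (Fin n → V1) → ℝ)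
    (τ2 : M2 → (Fin n → V2) → ℝ) : ℝ :=
  ∑ un : Fin n → U, ∑ m1 : M1, ∑ m2 : M2, ∑ v1n : Fin n → V1, ∑ v2n : Fin n → V2,
    ((∏ t, PU (un t)) * σ un (m1, m2) * τ1 (m1, m2) v1n * τ2 m2 v2n) *
      ((n : ℝ)⁻¹ * ∑ t, de (un t) (v1n t) (v2n t))

/-- Long-run distortion `d_1^n(σ,τ1)` of the first decoder. -/
noncomputable def d1N (PU : U → ℝ) (d1 : U → V1 → ℝ) {n : ℕ}
    (σ : (Fin n → U) → M1 × M2 → ℝ)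
    (τ1 : M1 × M2 → (Fin n → V1) → ℝ) : ℝ :=
  ∑ un : Fin n → U, ∑ m1 : M1, ∑ m2 : M2, ∑ v1n : Fin n → V1,
    ((∏ t, PU (un t)) * σ un (m1, m2) * τ1 (m1, m2) v1n) *
      ((n : ℝ)⁻¹ * ∑ t, d1 (un t) (v1n t))

/-- Long-run distortion `d_2^n(σ,τ2)` of the second decoder. -/
noncomputable def d2N (PU : U → ℝ) (d2 : U → V2 → ℝ) {n : ℕ}
    (σ : (Fin n → U) → M1 × M2 → ℝ)
    (τ2 : M2 → (Fin n → V2) → ℝ) : ℝ :=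
  ∑ un : Fin n → U, ∑ m1 : M1, ∑ m2 : M2, ∑ v2n : Fin n → V2,
    ((∏ t, PU (un t)) * σ un (m1, m2) * τ2 m2 v2n) *
      ((n : ℝ)⁻¹ * ∑ t, d2 (un t) (v2n t))

/-- Best responses of decoder 1 to the encoding strategy `σ`. -/
def BR1 (PU : U → ℝ) (d1 : U → V1 → ℝ) {n : ℕ}
    (σ : (Fin n → U) → M1 × M2 → ℝ) :
    Set (M1 × M2 → (Fin n → V1) → ℝ) :=
  {τ1 | IsKernel τ1 ∧ ∀ τ1' : M1 × M2 → (Fin n → V1) → ℝ,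
      IsKernel τ1' → d1N PU d1 σ τ1 ≤ d1N PU d1 σ τ1'}

/-- Best responses of decoder 2 to the encoding strategy `σ`. -/
def BR2 (PU : U → ℝ) (d2 : U → V2 → ℝ) {n : ℕ}
    (σ : (Fin n → U) → M1 × M2 → ℝ) :
    Set (M2 → (Fin n → V2) → ℝ) :=
  {τ2 | IsKernel τ2 ∧ ∀ τ2' : M2 → (Fin n → V2) → ℝ,
      IsKernel τ2' → d2N PU d2 σ τ2 ≤ d2N PU d2 σ τ2'}

/-- Worst-case encoder distortion over the best responses of the two decoders. -/
noncomputable def DeWorst (PU : U → ℝ) (de : U → V1 → V2 → ℝ) (d1 : U → V1 → ℝ)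
    (d2 : U → V2 → ℝ) {n : ℕ} (σ : (Fin n → U) → M1 × M2 → ℝ) : ℝ :=
  sSup {y | ∃ τ1 ∈ BR1 PU d1 σ, ∃ τ2 ∈ BR2 PU d2 σ, y = deN PU de σ τ1 τ2}

end Operational

/-- Optimal `n`-letter encoder distortion `D_e^n(R1,R2)`. -/
noncomputable def Dn {U V1 V2 : Type*} [Fintype U] [Fintype V1] [Fintype V2]
    (PU : U → ℝ) (de : U → V1 → V2 → ℝ) (d1 : U → V1 → ℝ) (d2 : U → V2 → ℝ)
    (R1 R2 : ℝ) (n : ℕ) : ℝ :=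
  sInf {x | ∃ σ : (Fin n → U) → Msg R1 n × Msg R2 n → ℝ, IsKernel σ ∧
    x = DeWorst PU de d1 d2 σ}

section SingleLetter

variable {U V1 V2 W1 W2 : Type*} [Fintype U] [Fintype V1] [Fintype V2]
  [Fintype W1] [Fintype W2]

/-- The information-constraint set `Q0(R1,R2)` of conditional distributions. -/
noncomputable def Q0set (PU : U → ℝ) (R1 R2 : ℝ) : Set (U → W1 × W2 → ℝ) :=
  {Q | IsKernel Q ∧
    miOfJoint (fun p : U × W2 => ∑ w1, PU p.1 * Q p.1 (w1, p.2)) ≤ R2 ∧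
    miOfJoint (fun p : U × (W1 × W2) => PU p.1 * Q p.1 p.2) ≤ R1 + R2}

/-- Expected distortion `E[d_1(U,V1)]` under `P_U · Q_{W1W2|U} · Q_{V1|W1W2}`. -/
noncomputable def E1 (PU : U → ℝ) (d1 : U → V1 → ℝ) (Q : U → W1 × W2 → ℝ)
    (k1 : W1 × W2 → V1 → ℝ) : ℝ :=
  ∑ u, ∑ w : W1 × W2, ∑ v1, PU u * Q u w * k1 w v1 * d1 u v1

/-- Expected distortion `E[d_2(U,V2)]` under `P_U · Q_{W2|U} · Q_{V2|W2}`. -/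
noncomputable def E2 (PU : U → ℝ) (d2 : U → V2 → ℝ) (Q : U → W1 × W2 → ℝ)
    (k2 : W2 → V2 → ℝ) : ℝ :=
  ∑ u, ∑ w2 : W2, ∑ v2, PU u * (∑ w1, Q u (w1, w2)) * k2 w2 v2 * d2 u v2

/-- Single-letter best responses `Q1(Q_{W1W2|U})` of decoder 1. -/
def Q1set (PU : U → ℝ) (d1 : U → V1 → ℝ) (Q : U → W1 × W2 → ℝ) :
    Set (W1 × W2 → V1 → ℝ) :=
  {k1 | IsKernel k1 ∧ ∀ k1' : W1 × W2 → V1 → ℝ, IsKernel k1' →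
      E1 PU d1 Q k1 ≤ E1 PU d1 Q k1'}

/-- Single-letter best responses `Q2(Q_{W2|U})` of decoder 2. -/
def Q2set (PU : U → ℝ) (d2 : U → V2 → ℝ) (Q : U → W1 × W2 → ℝ) :
    Set (W2 → V2 → ℝ) :=
  {k2 | IsKernel k2 ∧ ∀ k2' : W2 → V2 → ℝ, IsKernel k2' →
      E2 PU d2 Q k2 ≤ E2 PU d2 Q k2'}

/-- Expected encoder distortion `E[d_e(U,V1,V2)]` under
`P_U · Q_{W1W2|U} · Q_{V1|W1W2} · Q_{V2|W2}`. -/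
noncomputable def Ee (PU : U → ℝ) (de : U → V1 → V2 → ℝ) (Q : U → W1 × W2 → ℝ)
    (k1 : W1 × W2 → V1 → ℝ) (k2 : W2 → V2 → ℝ) : ℝ :=
  ∑ u, ∑ w : W1 × W2, ∑ v1, ∑ v2,
    PU u * Q u w * k1 w v1 * k2 w.2 v2 * de u v1 v2

end SingleLetter

/-- Single-letter optimal encoder distortion `D_e*(R1,R2)`, with auxiliary
alphabets `W1`, `W2`. -/
noncomputable def Dstar (W1 W2 : Type*) [Fintype W1] [Fintype W2]
    {U V1 V2 : Type*} [Fintype U] [Fintype V1] [Fintype V2]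
    (PU : U → ℝ) (de : U → V1 → V2 → ℝ) (d1 : U → V1 → ℝ) (d2 : U → V2 → ℝ)
    (R1 R2 : ℝ) : ℝ :=
  sInf {x | ∃ Q : U → W1 × W2 → ℝ, Q ∈ Q0set PU R1 R2 ∧
    x = sSup {y | ∃ k1 ∈ Q1set PU d1 Q, ∃ k2 ∈ Q2set PU d2 Q,
      y = Ee PU de Q k1 k2}}


lemma log_sum_aux {x y s : ℝ} (hx : 0 ≤ x) (hy : 0 ≤ y) (hs : 0 < s) (h : y = 0 → x = 0) :
    (x + s) * (Real.log (x + s) - Real.log (y + s)) ≤ x * (Real.log x - Real.log y) := by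
  have h1 : s * (Real.log (x + s) - Real.log (y + s)) ≤ s * ((x + s) / (y + s) - 1) := by
    apply mul_le_mul_of_nonneg_left _ hs.le
    rw [← Real.log_div (by positivity) (by positivity)]
    exact Real.log_le_sub_one_of_pos (by positivity)
  rcases hx.eq_or_lt with rfl | hx
  · have : s * ((0 + s) / (y + s) - 1) ≤ 0 := by
      apply mul_nonpos_of_nonneg_of_nonpos hs.le
      rw [sub_nonpos, div_le_one (by positivity)]
      linarith
    simp only [zero_add, zero_mul] at *
    linarith
  · have hy : 0 < y := lt_of_le_of_ne hy (fun e => hx.ne' (h e.symm))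
    have h2 : x * (Real.log (x + s) - Real.log (y + s) - (Real.log x - Real.log y))
        ≤ x * (((x + s) / (y + s)) / (x / y) - 1) := by
      apply mul_le_mul_of_nonneg_left _ hx.le
      rw [← Real.log_div (by positivity) (by positivity),
        ← Real.log_div (by positivity) (by positivity),
        ← Real.log_div (by positivity) (by positivity)]
      exact Real.log_le_sub_one_of_pos (by positivity)
    have h3 : x * (((x + s) / (y + s)) / (x / y) - 1) + s * ((x + s) / (y + s) - 1) = 0 := by
      field_simp
      ring
    linarith

lemma logb_sum_aux {x y s t : ℝ} (hx : 0 ≤ x) (hy : 0 ≤ y) (hs : 0 < s) (h : y = 0 → x = 0)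
    (ht : 0 < t) (ht1 : t ≤ 1) :
    ((1 - t) * x + t * s) *
      (Real.logb 2 ((1 - t) * x + t * s) - Real.logb 2 ((1 - t) * y + t * s))
      ≤ (1 - t) * (x * (Real.logb 2 x - Real.logb 2 y)) := by
  have h2 : 0 < Real.log 2 := Real.log_pos (by norm_num)
  have key : ((1 - t) * x + t * s) *
      (Real.log ((1 - t) * x + t * s) - Real.log ((1 - t) * y + t * s))
      ≤ (1 - t) * (x * (Real.log x - Real.log y)) := by
    rcases ht1.eq_or_lt with rfl | ht1
    · simp
    have h1 : 0 < 1 - t := by linarith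
    refine (log_sum_aux (by positivity) (by positivity) (by positivity) ?_).trans ?_
    · intro e
      rcases mul_eq_zero.1 e with e | e
      · linarith
      · simp [h e]
    · rcases hx.eq_or_lt with rfl | hx
      · simp
      · have hy : y ≠ 0 := fun e => hx.ne' (h e)
        rw [Real.log_mul h1.ne' hx.ne', Real.log_mul h1.ne' hy]
        apply le_of_eq
        ring
  simp only [Real.logb, ← sub_div, ← mul_div_assoc]
  gcongr

lemma mi_formula {U W : Type*} [Fintype U] [Fintype W] (P : U → ℝ)
    (hpos : ∀ u, 0 < P u) (K : U → W → ℝ) (hK : IsKernel K) :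
    miOfJoint (fun p : U × W => P p.1 * K p.1 p.2) =
      ∑ u, ∑ w, P u * (K u w * (Real.logb 2 (K u w) - Real.logb 2 (∑ v, P v * K v w))) := by
  have e1 : ∀ u, ∑ w, P u * K u w = P u := fun u => by
    rw [← Finset.mul_sum, (hK u).2, mul_one]
  have e2 : ∀ u w, P u * K u w * Real.logb 2 (P u * K u w) =
      P u * K u w * Real.logb 2 (P u) + P u * K u w * Real.logb 2 (K u w) := by
    intro u w
    by_cases h : K u w = 0
    · simp [h]
    · rw [Real.logb_mul (hpos u).ne' h]; ring
  have e3 : ∑ w, (∑ v, P v * K v w) * Real.logb 2 (∑ v, P v * K v w) =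
      ∑ u, ∑ w, P u * K u w * Real.logb 2 (∑ v, P v * K v w) := by
    rw [Finset.sum_comm]
    simp only [Finset.sum_mul]
  have e4 : ∀ u w, P u * (K u w * (Real.logb 2 (K u w) - Real.logb 2 (∑ v, P v * K v w))) =
      P u * K u w * Real.logb 2 (K u w) - P u * K u w * Real.logb 2 (∑ v, P v * K v w) := by
    intro u w; ring
  simp only [miOfJoint, ent, Fintype.sum_prod_type, e1, e2, e3, e4, Finset.sum_add_distrib,
    Finset.sum_sub_distrib]
  simp only [← Finset.sum_mul, e1]
  ring

lemma mi_mix {U W : Type*} [Fintype U] [Fintype W] (P : U → ℝ) (hP : IsDist P)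
    (hpos : ∀ u, 0 < P u) (K : U → W → ℝ) (hK : IsKernel K) (k : W → ℝ) (hk : ∀ w, 0 < k w)
    {t : ℝ} (ht : 0 < t) (ht1 : t ≤ 1)
    (hM : IsKernel (fun (u : U) w => (1 - t) * K u w + t * k w)) :
    miOfJoint (fun p : U × W => P p.1 * ((1 - t) * K p.1 p.2 + t * k p.2)) ≤
      (1 - t) * miOfJoint (fun p : U × W => P p.1 * K p.1 p.2) := by
  rw [mi_formula P hpos (fun u w => (1 - t) * K u w + t * k w) hM, mi_formula P hpos K hK]
  have e : ∀ w, ∑ v, P v * ((1 - t) * K v w + t * k w) =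
      (1 - t) * (∑ v, P v * K v w) + t * k w := by
    intro w
    have : ∀ v, P v * ((1 - t) * K v w + t * k w) =
      (1 - t) * (P v * K v w) + P v * (t * k w) := fun v => by ring
    simp only [this, Finset.sum_add_distrib, ← Finset.mul_sum, ← Finset.sum_mul, hP.2, one_mul]
  simp only [e, Finset.mul_sum (a := 1 - t)]
  refine Finset.sum_le_sum fun u _ => Finset.sum_le_sum fun w _ => ?_
  rw [mul_left_comm (1 - t)]
  refine mul_le_mul_of_nonneg_left ?_ (hpos u).le
  have hn : ∀ v ∈ Finset.univ, 0 ≤ P v * K v w := fun v _ => mul_nonneg (hpos v).le ((hK v).1 w)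
  have := logb_sum_aux ((hK u).1 w) (Finset.sum_nonneg hn) (hk w) (fun h => ?_) ht ht1
  · simpa only [Finset.mul_sum] using this
  · have := (Finset.sum_eq_zero_iff_of_nonneg hn).1 h u (Finset.mem_univ u)
    exact (mul_eq_zero.1 this).resolve_left (hpos u).ne'

lemma ent_continuous {X α : Type*} [TopologicalSpace X] [Fintype α] (f : X → α → ℝ)
    (hf : ∀ a, Continuous fun x => f x a) : Continuous fun x => ent (f x) := by
  unfold ent
  refine (continuous_finsetSum _ fun a _ => ?_).neg
  have := (Real.continuous_mul_log.comp (hf a)).div_const (Real.log 2)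
  simpa only [Real.logb, mul_div_assoc, Function.comp_def] using this

lemma mi_continuous {X α β : Type*} [TopologicalSpace X] [Fintype α] [Fintype β]
    (f : X → α × β → ℝ) (hf : ∀ a, Continuous fun x => f x a) :
    Continuous fun x => miOfJoint (f x) := by
  unfold miOfJoint
  refine ((ent_continuous _ fun a => ?_).add (ent_continuous _ fun a => ?_)).sub
    (ent_continuous _ hf)
  · exact continuous_finsetSum _ fun b _ => hf _
  · exact continuous_finsetSum _ fun b _ => hf _

lemma dense_aux
    {U W1 W2 : Type*} [Fintype U] [Fintype W1] [Fintype W2]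
    [Nonempty W1] [Nonempty W2]
    (PU : U → ℝ) (hPU : IsDist PU) (hPUpos : ∀ u, 0 < PU u)
    (Q : U → W1 × W2 → ℝ) (hQ : IsKernel Q) (t : ℝ) (ht : 0 < t) (ht1 : t ≤ 1) :
    ∃ hM : IsKernel (fun (u : U) (w : W1 × W2) =>
        (1 - t) * Q u w + t * (Fintype.card (W1 × W2) : ℝ)⁻¹),
      miOfJoint (fun p : U × W2 => ∑ w1, PU p.1 * ((1 - t) * Q p.1 (w1, p.2)
          + t * (Fintype.card (W1 × W2) : ℝ)⁻¹)) ≤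
        (1 - t) * miOfJoint (fun p : U × W2 => ∑ w1 : W1, PU p.1 * Q p.1 (w1, p.2)) ∧
      miOfJoint (fun p : U × (W1 × W2) => PU p.1 * ((1 - t) * Q p.1 p.2
          + t * (Fintype.card (W1 × W2) : ℝ)⁻¹)) ≤
        (1 - t) * miOfJoint (fun p : U × (W1 × W2) => PU p.1 * Q p.1 p.2) := by
  have hc : 0 < (Fintype.card (W1 × W2) : ℝ)⁻¹ := by
    have : 0 < Fintype.card (W1 × W2) := Fintype.card_pos
    positivity
  have h1 : 0 ≤ 1 - t := by linarith
  have hM : IsKernel (fun (u : U) (w : W1 × W2) =>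
        (1 - t) * Q u w + t * (Fintype.card (W1 × W2) : ℝ)⁻¹) := by
    intro u
    refine ⟨fun w => add_nonneg (mul_nonneg h1 ((hQ u).1 w)) (by positivity), ?_⟩
    rw [Finset.sum_add_distrib, ← Finset.mul_sum, (hQ u).2, Finset.sum_const, nsmul_eq_mul,
      Finset.card_univ]
    field_simp [(inv_pos.1 hc).ne']
    ring
  have marg : ∀ K : U → W1 × W2 → ℝ, IsKernel K →
      IsKernel (fun u (w2 : W2) => ∑ w1 : W1, K u (w1, w2)) := by
    intro K hK u
    refine ⟨fun w => Finset.sum_nonneg fun w1 _ => (hK u).1 _, ?_⟩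
    rw [← (hK u).2, Fintype.sum_prod_type_right]
  refine ⟨hM, ?_, mi_mix PU hPU hPUpos Q hQ _ (fun _ => hc) ht ht1 hM⟩
  have e : ∀ u w2, ∑ w1 : W1, ((1 - t) * Q u (w1, w2) + t * (Fintype.card (W1 × W2) : ℝ)⁻¹) =
      (1 - t) * ∑ w1 : W1, Q u (w1, w2)
        + t * (Fintype.card W1 * (Fintype.card (W1 × W2) : ℝ)⁻¹) := by
    intro u w2
    rw [Finset.sum_add_distrib, ← Finset.mul_sum, Finset.sum_const, nsmul_eq_mul,
      Finset.card_univ]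
    ring
  have hM2 := marg _ hM
  simp only [e] at hM2
  simp only [← Finset.mul_sum, e]
  refine mi_mix PU hPU hPUpos _ (marg Q hQ)
    (fun _ => Fintype.card W1 * (Fintype.card (W1 × W2) : ℝ)⁻¹) (fun _ => ?_) ht ht1 hM2
  have : 0 < Fintype.card W1 := Fintype.card_pos
  positivity

/-- for `(R1,R2) ∈ (0,∞)²`, the set `Q02(R1,R2)` of conditional
distributions with strict information constraints is nonempty, open, and dense
in `Q0(R1,R2)` (within the space of conditional distributions from `U` to
`W1 × W2`). -/
theorem stmt12_strict_constraints_dense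
    {U W1 W2 : Type*} [Fintype U] [Fintype W1] [Fintype W2]
    [Nonempty W1] [Nonempty W2]
    (PU : U → ℝ) (hPU : IsDist PU) (hPUpos : ∀ u, 0 < PU u)
    (R1 R2 : ℝ) (hR1 : 0 < R1) (hR2 : 0 < R2) :
    -- Q02 within the space of conditional distributions
    ({Q : {k : U → W1 × W2 → ℝ // IsKernel k} |
        miOfJoint (fun p : U × W2 => ∑ w1, PU p.1 * Q.1 p.1 (w1, p.2)) < R2 ∧
        miOfJoint (fun p : U × (W1 × W2) => PU p.1 * Q.1 p.1 p.2) < R1 + R2}).Nonempty ∧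
    IsOpen {Q : {k : U → W1 × W2 → ℝ // IsKernel k} |
        miOfJoint (fun p : U × W2 => ∑ w1, PU p.1 * Q.1 p.1 (w1, p.2)) < R2 ∧
        miOfJoint (fun p : U × (W1 × W2) => PU p.1 * Q.1 p.1 p.2) < R1 + R2} ∧
    {Q : {k : U → W1 × W2 → ℝ // IsKernel k} |
        miOfJoint (fun p : U × W2 => ∑ w1, PU p.1 * Q.1 p.1 (w1, p.2)) ≤ R2 ∧
        miOfJoint (fun p : U × (W1 × W2) => PU p.1 * Q.1 p.1 p.2) ≤ R1 + R2} ⊆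
      closure {Q : {k : U → W1 × W2 → ℝ // IsKernel k} |
        miOfJoint (fun p : U × W2 => ∑ w1, PU p.1 * Q.1 p.1 (w1, p.2)) < R2 ∧
        miOfJoint (fun p : U × (W1 × W2) => PU p.1 * Q.1 p.1 p.2) < R1 + R2} := by
  have hcl : {Q : {k : U → W1 × W2 → ℝ // IsKernel k} |
        miOfJoint (fun p : U × W2 => ∑ w1, PU p.1 * Q.1 p.1 (w1, p.2)) ≤ R2 ∧
        miOfJoint (fun p : U × (W1 × W2) => PU p.1 * Q.1 p.1 p.2) ≤ R1 + R2} ⊆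
      closure {Q : {k : U → W1 × W2 → ℝ // IsKernel k} |
        miOfJoint (fun p : U × W2 => ∑ w1, PU p.1 * Q.1 p.1 (w1, p.2)) < R2 ∧
        miOfJoint (fun p : U × (W1 × W2) => PU p.1 * Q.1 p.1 p.2) < R1 + R2} := by
    rintro ⟨Q, hQ⟩ ⟨hq1, hq2⟩
    simp only at hq1 hq2
    have ht : ∀ n : ℕ, 0 < 1 / ((n : ℝ) + 1) := fun n => by positivity
    have ht1 : ∀ n : ℕ, 1 / ((n : ℝ) + 1) ≤ 1 := fun n => by
      rw [div_le_one (by positivity)]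
      have : (0 : ℝ) ≤ n := by positivity
      linarith
    have H := fun n : ℕ => dense_aux PU hPU hPUpos Q hQ _ (ht n) (ht1 n)
    choose hM hb1 hb2 using H
    refine mem_closure_of_tendsto (b := Filter.atTop) (f := fun n : ℕ => ⟨_, hM n⟩) ?_
      (Filter.Eventually.of_forall fun n => ⟨?_, ?_⟩)
    · rw [tendsto_subtype_rng]
      have hlim := tendsto_one_div_add_atTop_nhds_zero_nat (𝕜 := ℝ)
      refine tendsto_pi_nhds.2 fun u => tendsto_pi_nhds.2 fun w => ?_
      have := ((hlim.const_sub 1).mul_const (Q u w)).add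
        (hlim.mul_const ((Fintype.card (W1 × W2) : ℝ)⁻¹))
      simpa using this
    · refine (hb1 n).trans_lt ?_
      nlinarith [ht n, ht1 n, mul_le_mul_of_nonneg_left hq1 (sub_nonneg.2 (ht1 n)),
        mul_pos (ht n) hR2]
    · refine (hb2 n).trans_lt ?_
      nlinarith [ht n, ht1 n, mul_le_mul_of_nonneg_left hq2 (sub_nonneg.2 (ht1 n)),
        mul_pos (ht n) (add_pos hR1 hR2)]
  refine ⟨?_, ?_, hcl⟩
  · have hQ : IsKernel (fun (_ : U) (_ : W1 × W2) => (Fintype.card (W1 × W2) : ℝ)⁻¹) := by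
      intro u
      refine ⟨fun w => by positivity, ?_⟩
      have : (0 : ℝ) < Fintype.card (W1 × W2) := by exact_mod_cast Fintype.card_pos
      rw [Finset.sum_const, nsmul_eq_mul, Finset.card_univ, mul_inv_cancel₀ this.ne']
    obtain ⟨hM, h1, h2⟩ := dense_aux PU hPU hPUpos _ hQ 1 one_pos le_rfl
    refine ⟨⟨_, hM⟩, h1.trans_lt ?_, h2.trans_lt ?_⟩
    · simpa using hR2
    · simpa using add_pos hR1 hR2
  · have hev : ∀ (u : U) (w : W1 × W2),
        Continuous fun Q : {k : U → W1 × W2 → ℝ // IsKernel k} => Q.1 u w := fun u w =>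
      (continuous_apply w).comp ((continuous_apply u).comp continuous_subtype_val)
    refine (isOpen_lt (mi_continuous _ fun p => ?_) continuous_const).inter
      (isOpen_lt (mi_continuous _ fun p => ?_) continuous_const)
    · exact continuous_finsetSum _ fun w1 _ => continuous_const.mul (hev _ _)
    · exact continuous_const.mul (hev _ _)

end Persuasion
end

section
/- In the degenerate case R1 = R2 = 0, the n-letter and single-letter values coincide exactly at every blocklength: for every n ≥ 1, D_e^n(0,0) = D_e*(0,0). -/
open scoped BigOperators

namespace Persuasion

/-- abstract objective -/
noncomputable def obj {W X : Type*} [Fintype W] [Fintype X] (q : W → ℝ) (f : X → ℝ)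
    (k : W → X → ℝ) : ℝ := ∑ w, ∑ x, q w * k w x * f x

/-- abstract best responses -/
def BRset {W X : Type*} [Fintype W] [Fintype X] (q : W → ℝ) (f : X → ℝ) :
    Set (W → X → ℝ) :=
  {k | IsKernel k ∧ ∀ k' : W → X → ℝ, IsKernel k' → obj q f k ≤ obj q f k'}

/-- abstract encoder objective -/
noncomputable def objE {W1 W2 X Y : Type*} [Fintype W1] [Fintype W2] [Fintype X] [Fintype Y]
    (q : W1 × W2 → ℝ) (h : X → Y → ℝ) (k1 : W1 × W2 → X → ℝ) (k2 : W2 → Y → ℝ) : ℝ :=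
  ∑ w : W1 × W2, ∑ x, ∑ y, q w * k1 w x * k2 w.2 y * h x y

lemma obj_const {W X : Type*} [Fintype W] [Fintype X] (q : W → ℝ)
    (k : W → X → ℝ) (hk : IsKernel k) (c : ℝ) : obj q (fun _ => c) k = (∑ w, q w) * c := by
  unfold obj
  rw [Finset.sum_mul]
  refine Finset.sum_congr rfl fun w _ => ?_
  rw [← Finset.sum_mul, ← Finset.mul_sum, (hk w).2, mul_one]

open Classical in
lemma dirac_kernel {W X : Type*} [Fintype X] (x0 : X) :
    IsKernel (fun (_ : W) (x : X) => if x = x0 then (1:ℝ) else 0) := by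
  intro w
  refine ⟨fun x => ?_, by simp⟩
  dsimp only
  split_ifs <;> norm_num

open Classical in
lemma obj_dirac {W X : Type*} [Fintype W] [Fintype X] (q : W → ℝ) (f : X → ℝ) (x0 : X) :
    obj q f (fun (_ : W) (x : X) => if x = x0 then (1:ℝ) else 0) = (∑ w, q w) * f x0 := by
  simp [obj, Finset.sum_mul]

lemma obj_ge {W X : Type*} [Fintype W] [Fintype X] (q : W → ℝ) (hq : ∀ w, 0 ≤ q w)
    (f : X → ℝ) (x0 : X) (hx0 : ∀ x, f x0 ≤ f x) (k : W → X → ℝ) (hk : IsKernel k) :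
    (∑ w, q w) * f x0 ≤ obj q f k := by
  rw [← obj_const q k hk]
  unfold obj
  refine Finset.sum_le_sum fun w _ => Finset.sum_le_sum fun x _ => ?_
  exact mul_le_mul_of_nonneg_left (hx0 x) (mul_nonneg (hq w) ((hk w).1 x))

open Classical in
lemma dirac_mem {W X : Type*} [Fintype W] [Fintype X] (q : W → ℝ) (hq : ∀ w, 0 ≤ q w)
    (f : X → ℝ) (x0 : X) (hx0 : ∀ x, f x0 ≤ f x) :
    (fun (_ : W) (x : X) => if x = x0 then (1:ℝ) else 0) ∈ BRset q f := by
  refine ⟨dirac_kernel x0, fun k' hk' => ?_⟩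
  rw [obj_dirac]
  exact obj_ge q hq f x0 hx0 k' hk'

open Classical in
lemma BR_supp {W X : Type*} [Fintype W] [Fintype X] (q : W → ℝ) (hq : ∀ w, 0 ≤ q w)
    (f : X → ℝ) (x0 : X) (hx0 : ∀ x, f x0 ≤ f x) (k : W → X → ℝ) (hk : k ∈ BRset q f)
    (w : W) (x : X) (hw : q w ≠ 0) (hx : k w x ≠ 0) : f x = f x0 := by
  have h1 := hk.2 _ (dirac_kernel x0)
  rw [obj_dirac, ← obj_const q k hk.1] at h1
  have h2 : ∀ w x, 0 ≤ q w * k w x * f x - q w * k w x * f x0 := fun w x => by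
    rw [← mul_sub]
    exact mul_nonneg (mul_nonneg (hq w) ((hk.1 w).1 x)) (sub_nonneg.2 (hx0 x))
  have h3 : ∑ w, ∑ x, (q w * k w x * f x - q w * k w x * f x0) ≤ 0 := by
    simp only [Finset.sum_sub_distrib]
    unfold obj at h1
    linarith
  have h4 := le_antisymm h3 (Finset.sum_nonneg fun w _ => Finset.sum_nonneg fun x _ => h2 w x)
  rw [Finset.sum_eq_zero_iff_of_nonneg (fun w _ => Finset.sum_nonneg fun x _ => h2 w x)] at h4
  have h5 := h4 w (Finset.mem_univ _)
  rw [Finset.sum_eq_zero_iff_of_nonneg (fun x _ => h2 w x)] at h5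
  have h6 := h5 x (Finset.mem_univ _)
  rw [← mul_sub] at h6
  have := (mul_eq_zero.1 h6).resolve_left (mul_ne_zero hw hx)
  linarith

open Classical in
lemma sSup_abstract {W1 W2 X Y : Type*} [Fintype W1] [Fintype W2] [Fintype X] [Fintype Y]
    (q : W1 × W2 → ℝ) (hq : IsDist q) (f : X → ℝ) (g : Y → ℝ) (h : X → Y → ℝ)
    (x0 : X) (y0 : Y) (hx0 : ∀ x, f x0 ≤ f x) (hy0 : ∀ y, g y0 ≤ g y)
    (hM : ∀ x y, f x = f x0 → g y = g y0 → h x y ≤ h x0 y0) :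
    sSup {z | ∃ k1 ∈ BRset q f, ∃ k2 ∈ BRset (fun w2 => ∑ w1, q (w1, w2)) g,
      z = objE q h k1 k2} = h x0 y0 := by
  have hq2 : ∀ w2, 0 ≤ ∑ w1, q (w1, w2) := fun w2 => Finset.sum_nonneg fun w1 _ => hq.1 _
  apply IsGreatest.csSup_eq
  constructor
  · refine ⟨_, dirac_mem q hq.1 f x0 hx0, _, dirac_mem _ hq2 g y0 hy0, ?_⟩
    simp [objE, ← Finset.sum_mul, hq.2]
  · rintro z ⟨k1, hk1, k2, hk2, rfl⟩
    have e : ∑ w : W1 × W2, ∑ x, ∑ y, q w * k1 w x * k2 w.2 y * h x0 y0 = h x0 y0 := by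
      simp only [← Finset.sum_mul, ← Finset.mul_sum, (hk2.1 _).2, (hk1.1 _).2, mul_one, hq.2,
        one_mul]
    rw [← e]
    unfold objE
    refine Finset.sum_le_sum fun w _ => Finset.sum_le_sum fun x _ =>
      Finset.sum_le_sum fun y _ => ?_
    by_cases hz : q w * k1 w x * k2 w.2 y = 0
    · rw [hz]; simp
    · have hz' := hz
      simp only [mul_eq_zero, not_or] at hz
      obtain ⟨⟨ha, hb⟩, hc⟩ := hz
      have hq2w : (∑ w1, q (w1, w.2)) ≠ 0 := by
        have h1 : q w ≤ ∑ w1, q (w1, w.2) :=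
          Finset.single_le_sum (f := fun w1 => q (w1, w.2)) (fun i _ => hq.1 _)
            (Finset.mem_univ w.1)
        have h2 := lt_of_le_of_ne (hq.1 w) (Ne.symm ha)
        linarith
      refine mul_le_mul_of_nonneg_left (hM x y ?_ ?_)
        (mul_nonneg (mul_nonneg (hq.1 _) ((hk1.1 _).1 _)) ((hk2.1 _).1 _))
      · exact BR_supp q hq.1 f x0 hx0 k1 hk1 w x ha hb
      · exact BR_supp _ hq2 g y0 hy0 k2 hk2 w.2 y hq2w hc

/-- mutual information as a divergence -/
lemma mi_nonpos_indep {α β : Type*} [Fintype α] [Fintype β] (p : α × β → ℝ)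
    (hp : IsDist p) (h : miOfJoint p ≤ 0) (a : α) (b : β) :
    p (a, b) = (∑ b, p (a, b)) * (∑ a, p (a, b)) := by
  set A : α → ℝ := fun a => ∑ b, p (a, b) with hA
  set B : β → ℝ := fun b => ∑ a, p (a, b) with hB
  have hA0 : ∀ a, 0 ≤ A a := fun a => Finset.sum_nonneg fun _ _ => hp.1 _
  have hB0 : ∀ a, 0 ≤ B a := fun a => Finset.sum_nonneg fun _ _ => hp.1 _
  have hA1 : ∑ a, A a = 1 := by rw [← hp.2, Fintype.sum_prod_type]
  have hB1 : ∑ b, B b = 1 := by rw [← hp.2, Fintype.sum_prod_type_right]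
  have hl2 : 0 < Real.log 2 := Real.log_pos (by norm_num)
  have hmi : miOfJoint p * Real.log 2 = ∑ a, ∑ b, (p (a, b) * Real.log (p (a, b))
      - p (a, b) * Real.log (A a) - p (a, b) * Real.log (B b)) := by
    have e1 : ∑ a, A a * Real.logb 2 (A a) = ∑ a, ∑ b, p (a, b) * Real.logb 2 (A a) := by
      simp only [hA, Finset.sum_mul]
    have e2 : ∑ b, B b * Real.logb 2 (B b) = ∑ a, ∑ b, p (a, b) * Real.logb 2 (B b) := by
      rw [Finset.sum_comm]
      simp only [hB, Finset.sum_mul]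
    have e0 : miOfJoint p = ∑ a, ∑ b, (p (a, b) * Real.logb 2 (p (a, b))
      - p (a, b) * Real.logb 2 (A a) - p (a, b) * Real.logb 2 (B b)) := by
      simp only [Finset.sum_sub_distrib, ← e1, ← e2]
      simp only [miOfJoint, ent, Fintype.sum_prod_type]
      ring
    rw [e0, Finset.sum_mul]
    refine Finset.sum_congr rfl fun a _ => ?_
    rw [Finset.sum_mul]
    refine Finset.sum_congr rfl fun b _ => ?_
    simp only [Real.logb]
    field_simp
  have hT : ∀ a b, (0 ≤ p (a, b) * Real.log (p (a, b))
      - p (a, b) * Real.log (A a) - p (a, b) * Real.log (B b) - (p (a, b) - A a * B b)) ∧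
      (p (a, b) * Real.log (p (a, b))
      - p (a, b) * Real.log (A a) - p (a, b) * Real.log (B b) - (p (a, b) - A a * B b) = 0 →
      p (a, b) = A a * B b) := by
    intro a b
    rcases (hp.1 (a, b)).eq_or_lt with h0 | h0
    · rw [← h0]
      have := mul_nonneg (hA0 a) (hB0 b)
      constructor
      · linarith
      · intro h; linarith
    · have ha : 0 < A a := lt_of_lt_of_le h0
        (Finset.single_le_sum (f := fun b => p (a, b)) (fun _ _ => hp.1 _) (Finset.mem_univ b))
      have hb : 0 < B b := lt_of_lt_of_le h0
        (Finset.single_le_sum (f := fun a => p (a, b)) (fun _ _ => hp.1 _) (Finset.mem_univ a))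
      have hx : 0 < A a * B b / p (a, b) := by positivity
      have hlog : Real.log (A a * B b / p (a, b))
          = Real.log (A a) + Real.log (B b) - Real.log (p (a, b)) := by
        rw [Real.log_div (by positivity) h0.ne', Real.log_mul ha.ne' hb.ne']
      have hid : p (a, b) * (A a * B b / p (a, b)) = A a * B b := by field_simp
      have key : p (a, b) * Real.log (p (a, b))
        - p (a, b) * Real.log (A a) - p (a, b) * Real.log (B b) - (p (a, b) - A a * B b)
        = p (a, b) * (A a * B b / p (a, b) - 1 - Real.log (A a * B b / p (a, b))) := by
        rw [hlog, mul_sub, mul_sub, hid]; ring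
      rw [key]
      constructor
      · exact mul_nonneg h0.le (by linarith [Real.log_le_sub_one_of_pos hx])
      · intro h
        by_contra hne
        have hx1 : A a * B b / p (a, b) ≠ 1 := by
          intro h1
          rw [h1] at hid
          apply hne; linarith
        have := Real.log_lt_sub_one_of_pos hx hx1
        have h7 := (mul_eq_zero.1 h).resolve_left h0.ne'
        linarith
  have hs : ∑ a, ∑ b, (p (a, b) * Real.log (p (a, b))
      - p (a, b) * Real.log (A a) - p (a, b) * Real.log (B b) - (p (a, b) - A a * B b)) ≤ 0 := by
    have e3 : ∑ a, ∑ b, (p (a, b) - A a * B b) = 0 := by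
      simp only [Finset.sum_sub_distrib, ← Finset.mul_sum, hB1, mul_one, hA1]
      rw [← Fintype.sum_prod_type (f := p), hp.2]; ring
    simp only [Finset.sum_sub_distrib] at e3 hmi ⊢
    have : miOfJoint p * Real.log 2 ≤ 0 := mul_nonpos_of_nonpos_of_nonneg h hl2.le
    linarith
  have h4 := le_antisymm hs (Finset.sum_nonneg fun a _ => Finset.sum_nonneg fun b _ => (hT a b).1)
  rw [Finset.sum_eq_zero_iff_of_nonneg
    (fun a _ => Finset.sum_nonneg fun b _ => (hT a b).1)] at h4
  have h5 := h4 a (Finset.mem_univ _)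
  rw [Finset.sum_eq_zero_iff_of_nonneg (fun b _ => (hT a b).1)] at h5
  exact (hT a b).2 (h5 b (Finset.mem_univ _))

open Classical in
lemma mi_dirac {α β : Type*} [Fintype α] [Fintype β] (P : α → ℝ) (hP : IsDist P) (b0 : β) :
    miOfJoint (fun x : α × β => P x.1 * if x.2 = b0 then 1 else 0) = 0 := by
  have e : ∀ x y, (P x * if y = b0 then 1 else 0) * Real.logb 2 (P x * if y = b0 then 1 else 0)
      = if y = b0 then P x * Real.logb 2 (P x) else 0 := by
    intro x y; split_ifs <;> simp
  have e2 : ∀ y, (if y = b0 then (1:ℝ) else 0) * Real.logb 2 (if y = b0 then (1:ℝ) else 0) = 0 := by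
    intro y; split_ifs <;> simp
  simp only [miOfJoint, ent, ← Finset.sum_mul, ← Finset.mul_sum, hP.2, one_mul,
    Fintype.sum_prod_type, e, e2]
  simp [hP.2]

open Classical in
lemma sum_iid {U : Type*} [Fintype U] (PU : U → ℝ) (hPU : IsDist PU) {n : ℕ} (φ : U → ℝ)
    (t0 : Fin n) : ∑ un : Fin n → U, (∏ t, PU (un t)) * φ (un t0) = ∑ u, PU u * φ u := by
  have h := Finset.prod_univ_sum (fun _ : Fin n => (Finset.univ : Finset U))
    (fun t u => PU u * if t = t0 then φ u else 1)
  rw [Fintype.piFinset_univ] at h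
  have h1 : ∀ un : Fin n → U, ∏ t, (PU (un t) * if t = t0 then φ (un t) else 1)
      = (∏ t, PU (un t)) * φ (un t0) := by
    intro un
    rw [Finset.prod_mul_distrib]
    simp
  simp only [h1] at h
  rw [← h, Finset.prod_eq_single t0]
  · simp
  · intro t _ ht
    simp [ht, hPU.2]
  · simp

lemma sum_iid_avg {U : Type*} [Fintype U] (PU : U → ℝ) (hPU : IsDist PU) {n : ℕ}
    (φ : Fin n → U → ℝ) (c : ℝ) :
    ∑ un : Fin n → U, (∏ t, PU (un t)) * ((n : ℝ)⁻¹ * ∑ t, φ t (un t)) * c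
      = c * ((n : ℝ)⁻¹ * ∑ t, ∑ u, PU u * φ t u) := by
  have : ∀ t, ∑ u, PU u * φ t u = ∑ un : Fin n → U, (∏ t, PU (un t)) * φ t (un t) :=
    fun t => (sum_iid PU hPU (φ t) t).symm
  simp only [this]
  rw [Finset.sum_comm, Finset.mul_sum, Finset.mul_sum]
  refine Finset.sum_congr rfl fun un _ => ?_
  rw [← Finset.mul_sum]
  ring

lemma avg_min {X : Type*} {n : ℕ} (hn : 1 ≤ n) (D : X → ℝ) (x0 : X) (h0 : ∀ x, D x0 ≤ D x)
    (xs : Fin n → X) : (n : ℝ)⁻¹ * ∑ t : Fin n, D x0 ≤ (n : ℝ)⁻¹ * ∑ t, D (xs t) :=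
  mul_le_mul_of_nonneg_left (Finset.sum_le_sum fun t _ => h0 _) (by positivity)

lemma avg_min_eq {X : Type*} {n : ℕ} (hn : 1 ≤ n) (D : X → ℝ) (x0 : X) (h0 : ∀ x, D x0 ≤ D x)
    (xs : Fin n → X) (h : (n : ℝ)⁻¹ * ∑ t, D (xs t) = (n : ℝ)⁻¹ * ∑ t : Fin n, D x0)
    (t : Fin n) : D (xs t) = D x0 := by
  have hn' : ((n : ℝ)⁻¹) ≠ 0 := by positivity
  have h1 := mul_left_cancel₀ hn' h
  exact ((Finset.sum_eq_sum_iff_of_le (fun t _ => h0 (xs t))).1 h1.symm t (Finset.mem_univ _)).symm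

section nletter
variable {U V1 V2 M1 M2 : Type*} [Fintype U] [Fintype V1] [Fintype V2]
  [Fintype M1] [Fintype M2]

lemma d1N_eq (PU : U → ℝ) (hPU : IsDist PU) (d1 : U → V1 → ℝ) {n : ℕ}
    (σ : (Fin n → U) → M1 × M2 → ℝ) (hσ : ∀ un m, σ un m = 1) (τ1 : M1 × M2 → (Fin n → V1) → ℝ) :
    d1N PU d1 σ τ1 = obj (fun _ => 1)
      (fun v : Fin n → V1 => (n : ℝ)⁻¹ * ∑ t, ∑ u, PU u * d1 u (v t)) τ1 := by
  unfold d1N obj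
  have : ∀ (m : M1 × M2) (v : Fin n → V1), (1:ℝ) * τ1 m v * ((n : ℝ)⁻¹ * ∑ t, ∑ u, PU u * d1 u (v t))
    = ∑ un : Fin n → U, (∏ t, PU (un t)) * ((n : ℝ)⁻¹ * ∑ t, d1 (un t) (v t)) * τ1 m v := by
    intro m v
    rw [one_mul, sum_iid_avg PU hPU (fun t u => d1 u (v t))]
  simp only [this]
  have sw : ∀ F : (M1 × M2) → (Fin n → V1) → (Fin n → U) → ℝ,
      ∑ m, ∑ v, ∑ un, F m v un = ∑ un, ∑ m, ∑ v, F m v un := by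
    intro F
    rw [Finset.sum_comm (s := (Finset.univ : Finset (Fin n → U)))]
    refine Finset.sum_congr rfl fun m _ => ?_
    rw [Finset.sum_comm]
  rw [sw]
  refine Finset.sum_congr rfl fun un _ => ?_
  rw [Fintype.sum_prod_type]
  refine Finset.sum_congr rfl fun m1 _ => Finset.sum_congr rfl fun m2 _ =>
    Finset.sum_congr rfl fun v _ => ?_
  rw [hσ]; ring

lemma d2N_eq (PU : U → ℝ) (hPU : IsDist PU) (d2 : U → V2 → ℝ) {n : ℕ}
    (σ : (Fin n → U) → M1 × M2 → ℝ) (hσ : ∀ un m, σ un m = 1) (τ2 : M2 → (Fin n → V2) → ℝ) :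
    d2N PU d2 σ τ2 = obj (fun _ => ∑ _ : M1, 1)
      (fun v : Fin n → V2 => (n : ℝ)⁻¹ * ∑ t, ∑ u, PU u * d2 u (v t)) τ2 := by
  unfold d2N obj
  have : ∀ (m : M2) (v : Fin n → V2), (∑ _ : M1, (1:ℝ)) * τ2 m v *
      ((n : ℝ)⁻¹ * ∑ t, ∑ u, PU u * d2 u (v t))
    = ∑ un : Fin n → U, ∑ _ : M1, (∏ t, PU (un t)) *
      ((n : ℝ)⁻¹ * ∑ t, d2 (un t) (v t)) * τ2 m v := by
    intro m v
    have e := sum_iid_avg PU hPU (fun t u => d2 u (v t)) (τ2 m v)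
    simp only [Finset.sum_const, ← Finset.smul_sum]
    rw [e]
    simp only [nsmul_eq_mul]
    ring
  simp only [this]
  have sw : ∀ F : (Fin n → U) → M1 → M2 → (Fin n → V2) → ℝ,
      ∑ un, ∑ m1, ∑ m2, ∑ v, F un m1 m2 v = ∑ m2, ∑ v, ∑ un, ∑ m1, F un m1 m2 v := by
    intro F
    have : ∀ m2, ∑ v, ∑ un, ∑ m1, F un m1 m2 v = ∑ un, ∑ m1, ∑ v, F un m1 m2 v := by
      intro m2
      rw [Finset.sum_comm]
      refine Finset.sum_congr rfl fun un _ => ?_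
      rw [Finset.sum_comm]
    simp only [this]
    rw [Finset.sum_comm (s := (Finset.univ : Finset M2))]
    refine Finset.sum_congr rfl fun un _ => ?_
    rw [Finset.sum_comm]
  rw [sw]
  refine Finset.sum_congr rfl fun m2 _ => Finset.sum_congr rfl fun v _ =>
    Finset.sum_congr rfl fun un _ => Finset.sum_congr rfl fun m1 _ => ?_
  rw [hσ]; ring

lemma deN_eq (PU : U → ℝ) (hPU : IsDist PU) (de : U → V1 → V2 → ℝ) {n : ℕ}
    (σ : (Fin n → U) → M1 × M2 → ℝ) (hσ : ∀ un m, σ un m = 1) (τ1 : M1 × M2 → (Fin n → V1) → ℝ)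
    (τ2 : M2 → (Fin n → V2) → ℝ) :
    deN PU de σ τ1 τ2 = objE (fun _ => 1)
      (fun (v : Fin n → V1) (v' : Fin n → V2) =>
        (n : ℝ)⁻¹ * ∑ t, ∑ u, PU u * de u (v t) (v' t)) τ1 τ2 := by
  unfold deN objE
  have : ∀ (m : M1 × M2) (v : Fin n → V1) (v' : Fin n → V2),
    (1:ℝ) * τ1 m v * τ2 m.2 v' * ((n : ℝ)⁻¹ * ∑ t, ∑ u, PU u * de u (v t) (v' t))
    = ∑ un : Fin n → U, (∏ t, PU (un t)) * ((n : ℝ)⁻¹ * ∑ t, de (un t) (v t) (v' t)) *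
      (τ1 m v * τ2 m.2 v') := by
    intro m v v'
    rw [one_mul, sum_iid_avg PU hPU (fun t u => de u (v t) (v' t))]
  simp only [this]
  have sw : ∀ F : (M1 × M2) → (Fin n → V1) → (Fin n → V2) → (Fin n → U) → ℝ,
      ∑ m, ∑ v, ∑ v', ∑ un, F m v v' un = ∑ un, ∑ m, ∑ v, ∑ v', F m v v' un := by
    intro F
    rw [Finset.sum_comm (s := (Finset.univ : Finset (Fin n → U)))]
    refine Finset.sum_congr rfl fun m _ => ?_
    rw [Finset.sum_comm (s := (Finset.univ : Finset (Fin n → U)))]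
    refine Finset.sum_congr rfl fun v _ => ?_
    rw [Finset.sum_comm]
  rw [sw]
  refine Finset.sum_congr rfl fun un _ => ?_
  rw [Fintype.sum_prod_type]
  refine Finset.sum_congr rfl fun m1 _ => Finset.sum_congr rfl fun m2 _ =>
    Finset.sum_congr rfl fun v _ => Finset.sum_congr rfl fun v' _ => ?_
  rw [hσ]; ring

end nletter

section sletter
variable {U V1 V2 W1 W2 : Type*} [Fintype U] [Fintype V1] [Fintype V2]
  [Fintype W1] [Fintype W2]

lemma E1_eq (PU : U → ℝ) (d1 : U → V1 → ℝ) (Q : U → W1 × W2 → ℝ) (q : W1 × W2 → ℝ)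
    (hQ : ∀ u w, PU u * Q u w = PU u * q w) (k1 : W1 × W2 → V1 → ℝ) :
    E1 PU d1 Q k1 = obj q (fun v => ∑ u, PU u * d1 u v) k1 := by
  unfold E1 obj
  simp only [hQ, Finset.mul_sum]
  rw [Finset.sum_comm]
  refine Finset.sum_congr rfl fun w _ => ?_
  rw [Finset.sum_comm]
  refine Finset.sum_congr rfl fun v _ => Finset.sum_congr rfl fun u _ => ?_
  ring

lemma E2_eq (PU : U → ℝ) (d2 : U → V2 → ℝ) (Q : U → W1 × W2 → ℝ) (q : W1 × W2 → ℝ)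
    (hQ : ∀ u w, PU u * Q u w = PU u * q w) (k2 : W2 → V2 → ℝ) :
    E2 PU d2 Q k2 = obj (fun w2 => ∑ w1, q (w1, w2)) (fun v => ∑ u, PU u * d2 u v) k2 := by
  unfold E2 obj
  have : ∀ u w2, PU u * ∑ w1, Q u (w1, w2) = PU u * ∑ w1, q (w1, w2) := by
    intro u w2
    simp only [Finset.mul_sum, hQ]
  simp only [this]
  rw [Finset.sum_comm]
  refine Finset.sum_congr rfl fun w _ => ?_
  rw [Finset.sum_comm]
  refine Finset.sum_congr rfl fun v _ => ?_
  rw [Finset.mul_sum]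
  refine Finset.sum_congr rfl fun u _ => ?_
  ring

lemma Ee_eq (PU : U → ℝ) (de : U → V1 → V2 → ℝ) (Q : U → W1 × W2 → ℝ) (q : W1 × W2 → ℝ)
    (hQ : ∀ u w, PU u * Q u w = PU u * q w) (k1 : W1 × W2 → V1 → ℝ) (k2 : W2 → V2 → ℝ) :
    Ee PU de Q k1 k2 = objE q (fun v v' => ∑ u, PU u * de u v v') k1 k2 := by
  unfold Ee objE
  simp only [hQ]
  rw [Finset.sum_comm]
  refine Finset.sum_congr rfl fun w _ => ?_
  rw [Finset.sum_comm]
  refine Finset.sum_congr rfl fun v _ => ?_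
  rw [Finset.sum_comm]
  refine Finset.sum_congr rfl fun v' _ => ?_
  rw [Finset.mul_sum]
  refine Finset.sum_congr rfl fun u _ => ?_
  ring

open Classical in
lemma Q0_nonempty (PU : U → ℝ) (hPU : IsDist PU) (w0 : W1 × W2) :
    (fun (_ : U) (w : W1 × W2) => if w = w0 then (1:ℝ) else 0) ∈ Q0set PU 0 0 := by
  refine ⟨by convert dirac_kernel (W := U) w0, ?_, ?_⟩
  · have e : (fun p : U × W2 => ∑ w1 : W1, PU p.1 * if (w1, p.2) = w0 then (1:ℝ) else 0)
        = fun p : U × W2 => PU p.1 * if p.2 = w0.2 then 1 else 0 := by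
      funext p
      rw [← Finset.mul_sum]
      congr 1
      by_cases hp : p.2 = w0.2
      · simp [Prod.ext_iff, hp]
      · simp [Prod.ext_iff, hp]
    show miOfJoint (fun p : U × W2 => ∑ w1 : W1, PU p.1 * if (w1, p.2) = w0 then (1:ℝ) else 0) ≤ 0
    rw [e, mi_dirac PU hPU]
  · show miOfJoint (fun p : U × (W1 × W2) => PU p.1 * if p.2 = w0 then (1:ℝ) else 0) ≤ 0 + 0
    rw [add_zero]
    apply le_of_eq
    convert mi_dirac PU hPU w0

lemma Q0_indep (PU : U → ℝ) (hPU : IsDist PU) (Q : U → W1 × W2 → ℝ) (hQ : Q ∈ Q0set PU 0 0) :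
    ∃ q : W1 × W2 → ℝ, IsDist q ∧ ∀ u w, PU u * Q u w = PU u * q w := by
  obtain ⟨hK, -, hI⟩ := hQ
  have hd : IsDist (fun p : U × (W1 × W2) => PU p.1 * Q p.1 p.2) := by
    refine ⟨fun p => mul_nonneg (hPU.1 _) ((hK _).1 _), ?_⟩
    rw [Fintype.sum_prod_type]
    simp only [← Finset.mul_sum, (hK _).2, mul_one, hPU.2]
  refine ⟨fun w => ∑ u, PU u * Q u w, ⟨fun w => Finset.sum_nonneg fun u _ =>
    mul_nonneg (hPU.1 _) ((hK _).1 _), ?_⟩, fun u w => ?_⟩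
  · rw [Finset.sum_comm]
    simp only [← Finset.mul_sum, (hK _).2, mul_one, hPU.2]
  · have := mi_nonpos_indep _ hd (by linarith) u w
    simp only [← Finset.mul_sum, (hK _).2, mul_one] at this
    exact this

end sletter

lemma exists_tie {X Y : Type*} [Fintype X] [Fintype Y] [Nonempty X] [Nonempty Y]
    (f : X → ℝ) (g : Y → ℝ) (h : X → Y → ℝ) :
    ∃ x0 y0, (∀ x, f x0 ≤ f x) ∧ (∀ y, g y0 ≤ g y) ∧
      ∀ x y, f x = f x0 → g y = g y0 → h x y ≤ h x0 y0 := by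
  obtain ⟨a, ha⟩ := Finite.exists_min f
  obtain ⟨b, hb⟩ := Finite.exists_min g
  obtain ⟨⟨x0, y0⟩, hm, hM⟩ := Set.exists_max_image {z : X × Y | f z.1 = f a ∧ g z.2 = g b}
    (fun z => h z.1 z.2) (Set.toFinite _) ⟨(a, b), rfl, rfl⟩
  obtain ⟨h1, h2⟩ := hm
  refine ⟨x0, y0, fun x => h1 ▸ ha x, fun y => h2 ▸ hb y, fun x y hx hy => ?_⟩
  exact hM (x, y) ⟨hx.trans h1, hy.trans h2⟩

lemma no_kernel {A B : Type*} [Fintype B] [IsEmpty B] [Nonempty A] (k : A → B → ℝ) :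
    ¬ IsKernel k := by
  intro h
  have := (h (Classical.arbitrary A)).2
  simp at this

/-- in the degenerate case `R1 = R2 = 0`, for every `n ≥ 1`,
`D_e^n(0,0) = D_e*(0,0)`. -/
theorem stmt15_zero_rates
    {U V1 V2 : Type*} [Fintype U] [Fintype V1] [Fintype V2]
    (W1 W2 : Type*) [Fintype W1] [Fintype W2]
    (hW1 : Fintype.card W1 = Fintype.card V1)
    (hW2 : Fintype.card W2 = Fintype.card V2)
    (PU : U → ℝ) (hPU : IsDist PU)
    (de : U → V1 → V2 → ℝ) (d1 : U → V1 → ℝ) (d2 : U → V2 → ℝ)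
    (n : ℕ) (hn : 1 ≤ n) :
    Dn PU de d1 d2 0 0 n = Dstar W1 W2 PU de d1 d2 0 0 := by
  have hU : Nonempty U := by
    by_contra hU
    rw [not_nonempty_iff] at hU
    have := hPU.2
    simp at this
  have hone : ∀ m : ℕ, (2 ^ ⌊(m : ℝ) * 0⌋₊ : ℕ) = 1 := by intro m; simp
  haveI : Unique (Msg 0 n) := by
    unfold Msg
    rw [hone n]
    infer_instance
  have hσ1 : ∀ σ : (Fin n → U) → Msg 0 n × Msg 0 n → ℝ, IsKernel σ → ∀ un m, σ un m = 1 := by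
    intro σ hσ un m
    have := (hσ un).2
    rw [Fintype.sum_subsingleton _ m] at this
    exact this
  have hσex : IsKernel (fun (_ : Fin n → U) (_ : Msg 0 n × Msg 0 n) => (1:ℝ)) := by
    intro un
    refine ⟨fun _ => zero_le_one, ?_⟩
    rw [Fintype.sum_subsingleton _ (default, default)]
  by_cases hV : Nonempty V1 ∧ Nonempty V2
  · obtain ⟨hV1, hV2⟩ := hV
    have hW1' : Nonempty W1 := Fintype.card_pos_iff.1 (hW1 ▸ Fintype.card_pos)
    have hW2' : Nonempty W2 := Fintype.card_pos_iff.1 (hW2 ▸ Fintype.card_pos)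
    obtain ⟨x0, y0, hx0, hy0, hM⟩ := exists_tie (fun v => ∑ u, PU u * d1 u v)
      (fun v => ∑ u, PU u * d2 u v) (fun v v' => ∑ u, PU u * de u v v')
    have key1 : ∀ σ : (Fin n → U) → Msg 0 n × Msg 0 n → ℝ, IsKernel σ →
        DeWorst PU de d1 d2 σ = ∑ u, PU u * de u x0 y0 := by
      intro σ hσ
      have h1 := hσ1 σ hσ
      have h := sSup_abstract (fun _ : Msg 0 n × Msg 0 n => (1:ℝ)) (hσex (Classical.arbitrary _))
        (fun v : Fin n → V1 => (n : ℝ)⁻¹ * ∑ t, ∑ u, PU u * d1 u (v t))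
        (fun v : Fin n → V2 => (n : ℝ)⁻¹ * ∑ t, ∑ u, PU u * d2 u (v t))
        (fun (v : Fin n → V1) (v' : Fin n → V2) =>
          (n : ℝ)⁻¹ * ∑ t, ∑ u, PU u * de u (v t) (v' t))
        (fun _ => x0) (fun _ => y0)
        (fun x => avg_min hn (fun v => ∑ u, PU u * d1 u v) x0 hx0 x)
        (fun y => avg_min hn (fun v => ∑ u, PU u * d2 u v) y0 hy0 y)
        (fun x y hx hy => mul_le_mul_of_nonneg_left (Finset.sum_le_sum fun t _ => hM _ _
          (avg_min_eq hn (fun v => ∑ u, PU u * d1 u v) x0 hx0 x hx t)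
          (avg_min_eq hn (fun v => ∑ u, PU u * d2 u v) y0 hy0 y hy t)) (by positivity))
      have hc : (n : ℝ)⁻¹ * ∑ _t : Fin n, ∑ u, PU u * de u x0 y0 = ∑ u, PU u * de u x0 y0 := by
        have : (n : ℝ) ≠ 0 := by positivity
        rw [Finset.sum_const, Finset.card_univ, Fintype.card_fin, nsmul_eq_mul,
          inv_mul_cancel_left₀ this]
      rw [hc] at h
      unfold DeWorst BR1 BR2
      simp only [d1N_eq PU hPU d1 σ h1, d2N_eq PU hPU d2 σ h1, deN_eq PU hPU de σ h1]
      exact h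
    have key2 : ∀ Q : U → W1 × W2 → ℝ, Q ∈ Q0set PU 0 0 →
        sSup {y | ∃ k1 ∈ Q1set PU d1 Q, ∃ k2 ∈ Q2set PU d2 Q, y = Ee PU de Q k1 k2}
          = ∑ u, PU u * de u x0 y0 := by
      intro Q hQ
      obtain ⟨q, hq, hQq⟩ := Q0_indep PU hPU Q hQ
      have h := sSup_abstract q hq (fun v => ∑ u, PU u * d1 u v)
        (fun v => ∑ u, PU u * d2 u v) (fun v v' => ∑ u, PU u * de u v v') x0 y0 hx0 hy0 hM
      unfold Q1set Q2set
      simp only [E1_eq PU d1 Q q hQq, E2_eq PU d2 Q q hQq, Ee_eq PU de Q q hQq]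
      exact h
    have s1 : {x | ∃ σ : (Fin n → U) → Msg 0 n × Msg 0 n → ℝ, IsKernel σ ∧
        x = DeWorst PU de d1 d2 σ} = {∑ u, PU u * de u x0 y0} := by
      ext x
      constructor
      · rintro ⟨σ, hσ, rfl⟩
        exact key1 σ hσ
      · rintro rfl
        exact ⟨_, hσex, (key1 _ hσex).symm⟩
    have s2 : {x | ∃ Q : U → W1 × W2 → ℝ, Q ∈ Q0set PU 0 0 ∧
        x = sSup {y | ∃ k1 ∈ Q1set PU d1 Q, ∃ k2 ∈ Q2set PU d2 Q,
          y = Ee PU de Q k1 k2}} = {∑ u, PU u * de u x0 y0} := by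
      ext x
      constructor
      · rintro ⟨Q, hQ, rfl⟩
        exact key2 Q hQ
      · rintro rfl
        have hQ := Q0_nonempty (W1 := W1) (W2 := W2) PU hPU (Classical.arbitrary _)
        exact ⟨_, hQ, (key2 _ hQ).symm⟩
    unfold Dn Dstar
    rw [s1, s2]
  · have hWe : IsEmpty (W1 × W2) := by
      rw [isEmpty_prod]
      by_cases h1 : Nonempty V1
      · right
        have h2 : IsEmpty V2 := not_nonempty_iff.1 fun h2 => hV ⟨h1, h2⟩
        exact Fintype.card_eq_zero_iff.1 (hW2.trans Fintype.card_eq_zero)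
      · left
        have h2 : IsEmpty V1 := not_nonempty_iff.1 h1
        exact Fintype.card_eq_zero_iff.1 (hW1.trans Fintype.card_eq_zero)
    haveI : Nonempty (Fin n) := ⟨⟨0, hn⟩⟩
    have s2 : {x | ∃ Q : U → W1 × W2 → ℝ, Q ∈ Q0set PU 0 0 ∧
        x = sSup {y | ∃ k1 ∈ Q1set PU d1 Q, ∃ k2 ∈ Q2set PU d2 Q,
          y = Ee PU de Q k1 k2}} = ∅ := by
      ext x
      simp only [Set.mem_ofPred_eq, Set.mem_empty_iff_false, iff_false]
      rintro ⟨Q, hQ, -⟩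
      exact no_kernel Q hQ.1
    have key1 : ∀ σ : (Fin n → U) → Msg 0 n × Msg 0 n → ℝ, DeWorst PU de d1 d2 σ = 0 := by
      intro σ
      unfold DeWorst
      convert Real.sSup_empty
      ext x
      simp only [Set.mem_ofPred_eq, Set.mem_empty_iff_false, iff_false]
      rintro ⟨τ1, h1, τ2, h2, -⟩
      apply hV
      constructor
      · by_contra hc
        rw [not_nonempty_iff] at hc
        exact no_kernel τ1 h1.1
      · by_contra hc
        rw [not_nonempty_iff] at hc
        exact no_kernel τ2 h2.1
    have s1 : {x | ∃ σ : (Fin n → U) → Msg 0 n × Msg 0 n → ℝ, IsKernel σ ∧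
        x = DeWorst PU de d1 d2 σ} = {0} := by
      ext x
      constructor
      · rintro ⟨σ, hσ, rfl⟩
        exact key1 σ
      · rintro rfl
        exact ⟨_, hσex, (key1 _).symm⟩
    unfold Dn Dstar
    rw [s1, s2]
    simp

end Persuasion
end

section
/- Let R1 > 0, R2 > 0 and let Q_{W1W2|U} satisfy R2 > I(U;W2), R1+R2 > I(U;W1,W2), and the singleton worst-case action condition (Q_{W1W2|U} ∈ Q̃0(R1,R2)). Then for all ε > 0, α > 0, γ > 0, there exists δ̄ > 0 such that for all 0 < δ ≤ δ̄ there exists n̄ ∈ ℕ such that for all n ≥ n̄ there exist an encoding strategy σ : U^n → Δ(M1×M2) and deterministic codeword maps g1 : M1×M2 → W1^n, g2 : M2 → W2^n with P^σ( (M1, M2, g1(M1,M2), g2(M2)) ∈ B_{α,γ,δ} ) ≥ 1 − ε. -/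
open scoped BigOperators

namespace Persuasion

section Posteriors

variable {U V1 V2 W1 W2 : Type*} [Fintype U] [Fintype V1] [Fintype V2]
  [Fintype W1] [Fintype W2]

/-- Probability `P(w1,w2) = ∑_u P_U(u)·Q(w1,w2|u)`. -/
noncomputable def Pw (PU : U → ℝ) (Q : U → W1 × W2 → ℝ) (w : W1 × W2) : ℝ :=
  ∑ u, PU u * Q u w

/-- Bayesian posterior `Q_U^{w1,w2}` of `U` given `(W1,W2) = (w1,w2)`. -/
noncomputable def post (PU : U → ℝ) (Q : U → W1 × W2 → ℝ) (w : W1 × W2) (u : U) : ℝ :=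
  PU u * Q u w / Pw PU Q w

/-- Probability `P(w2)`. -/
noncomputable def Pw2 (PU : U → ℝ) (Q : U → W1 × W2 → ℝ) (w2 : W2) : ℝ :=
  ∑ w1, Pw PU Q (w1, w2)

/-- Bayesian posterior `Q_U^{w2}` of `U` given `W2 = w2`. -/
noncomputable def post2 (PU : U → ℝ) (Q : U → W1 × W2 → ℝ) (w2 : W2) (u : U) : ℝ :=
  (∑ w1, PU u * Q u (w1, w2)) / Pw2 PU Q w2

/-- Optimal actions `V1*(q)` of decoder 1 under belief `q`. -/
def V1star (d1 : U → V1 → ℝ) (q : U → ℝ) : Set V1 :=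
  {v1 | ∀ v1' : V1, (∑ u, q u * d1 u v1) ≤ ∑ u, q u * d1 u v1'}

/-- Optimal actions `V2*(q)` of decoder 2 under belief `q`. -/
def V2star (d2 : U → V2 → ℝ) (q : U → ℝ) : Set V2 :=
  {v2 | ∀ v2' : V2, (∑ u, q u * d2 u v2) ≤ ∑ u, q u * d2 u v2'}

/-- The set `Ã(Q_{W1W2|U},w1,w2)` of optimal action pairs that are worst for
the encoder. -/
def Atilde (PU : U → ℝ) (de : U → V1 → V2 → ℝ) (d1 : U → V1 → ℝ) (d2 : U → V2 → ℝ)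
    (Q : U → W1 × W2 → ℝ) (w1 : W1) (w2 : W2) : Set (V1 × V2) :=
  {p | p.1 ∈ V1star d1 (post PU Q (w1, w2)) ∧ p.2 ∈ V2star d2 (post2 PU Q w2) ∧
    ∀ p' : V1 × V2, p'.1 ∈ V1star d1 (post PU Q (w1, w2)) →
      p'.2 ∈ V2star d2 (post2 PU Q w2) →
      (∑ u, post PU Q (w1, w2) u * de u p'.1 p'.2) ≤
        ∑ u, post PU Q (w1, w2) u * de u p.1 p.2}

end Posteriors

/-- Kullback–Leibler divergence (in bits) between distributions on a finite
alphabet. -/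
noncomputable def KL {α : Type*} [Fintype α] (p q : α → ℝ) : ℝ :=
  ∑ a, p a * Real.logb 2 (p a / q a)

section Beliefs

variable {U M1 M2 : Type*} [Fintype U] [Fintype M1] [Fintype M2] [DecidableEq U]

/-- The law `P^σ(u^n,m1,m2) = (∏_t P_U(u_t))·σ(m1,m2|u^n)`. -/
noncomputable def Pn (PU : U → ℝ) {n : ℕ} (σ : (Fin n → U) → M1 × M2 → ℝ)
    (un : Fin n → U) (m1 : M1) (m2 : M2) : ℝ :=
  (∏ t, PU (un t)) * σ un (m1, m2)

/-- Probability of the message pair `(m1,m2)` under `P^σ`. -/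
noncomputable def pMsg (PU : U → ℝ) {n : ℕ} (σ : (Fin n → U) → M1 × M2 → ℝ)
    (m1 : M1) (m2 : M2) : ℝ :=
  ∑ un, Pn PU σ un m1 m2

/-- Bayesian belief `P_t^{m1,m2}(u) = P^σ(U_t = u | M1 = m1, M2 = m2)`. -/
noncomputable def belief (PU : U → ℝ) {n : ℕ} (σ : (Fin n → U) → M1 × M2 → ℝ)
    (t : Fin n) (m1 : M1) (m2 : M2) (u : U) : ℝ :=
  (∑ un, if un t = u then Pn PU σ un m1 m2 else 0) / pMsg PU σ m1 m2

/-- Probability of the message `m2` under `P^σ`. -/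
noncomputable def pMsg2 (PU : U → ℝ) {n : ℕ} (σ : (Fin n → U) → M1 × M2 → ℝ)
    (m2 : M2) : ℝ :=
  ∑ m1, pMsg PU σ m1 m2

/-- Bayesian belief `P_t^{m2}(u) = P^σ(U_t = u | M2 = m2)`. -/
noncomputable def belief2 (PU : U → ℝ) {n : ℕ} (σ : (Fin n → U) → M1 × M2 → ℝ)
    (t : Fin n) (m2 : M2) (u : U) : ℝ :=
  (∑ m1, ∑ un, if un t = u then Pn PU σ un m1 m2 else 0) / pMsg2 PU σ m2

end Beliefs

section Bset

variable {U V1 V2 W1 W2 M1 M2 : Type*} [Fintype U] [Fintype V1] [Fintype V2]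
  [Fintype W1] [Fintype W2] [Fintype M1] [Fintype M2] [DecidableEq U]

/-- Worst-case expected encoder distortion
`D_e^t(σ,m1,m2) = max_{v1∈V1*(P_t^{m1,m2}), v2∈V2*(P_t^{m2})} ∑_u P_t^{m1,m2}(u) d_e(u,v1,v2)`. -/
noncomputable def Det (PU : U → ℝ) (de : U → V1 → V2 → ℝ) (d1 : U → V1 → ℝ)
    (d2 : U → V2 → ℝ) {n : ℕ} (σ : (Fin n → U) → M1 × M2 → ℝ)
    (t : Fin n) (m1 : M1) (m2 : M2) : ℝ :=
  sSup {x | ∃ v1 ∈ V1star d1 (belief PU σ t m1 m2),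
    ∃ v2 ∈ V2star d2 (belief2 PU σ t m2),
    x = ∑ u, belief PU σ t m1 m2 u * de u v1 v2}

/-- Worst-case expected encoder distortion at the posterior beliefs:
`D_e^w(Q_{W1W2|U},w1,w2)`. -/
noncomputable def Dew (PU : U → ℝ) (de : U → V1 → V2 → ℝ) (d1 : U → V1 → ℝ)
    (d2 : U → V2 → ℝ) (Q : U → W1 × W2 → ℝ) (w1 : W1) (w2 : W2) : ℝ :=
  sSup {x | ∃ v1 ∈ V1star d1 (post PU Q (w1, w2)),
    ∃ v2 ∈ V2star d2 (post2 PU Q w2),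
    x = ∑ u, post PU Q (w1, w2) u * de u v1 v2}

/-- Empirical frequency of the pair `(w1,w2)` in the sequences `(w1^n,w2^n)`. -/
noncomputable def freq {n : ℕ} (w1n : Fin n → W1) (w2n : Fin n → W2)
    (w1 : W1) (w2 : W2) : ℝ :=
  (Nat.card {t : Fin n // w1n t = w1 ∧ w2n t = w2} : ℝ) / n

/-- Membership in the set `B_{α,γ,δ}`: at least a fraction `1−γ` of the stages
have Bayesian beliefs `α`-close (in KL divergence) to the target posteriors,
and the empirical frequency of `(w1,w2)`-pairs is `δ`-close to `P(w1,w2)`. -/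
def inB (PU : U → ℝ) (Q : U → W1 × W2 → ℝ)
    {n : ℕ} (σ : (Fin n → U) → M1 × M2 → ℝ) (α γ δ : ℝ)
    (m1 : M1) (m2 : M2) (w1n : Fin n → W1) (w2n : Fin n → W2) : Prop :=
  1 - γ ≤ (Nat.card {t : Fin n //
      max (KL (belief PU σ t m1 m2) (post PU Q (w1n t, w2n t)))
          (KL (belief2 PU σ t m2) (post2 PU Q (w2n t))) ≤
        α ^ 2 / (2 * Real.log 2)} : ℝ) / n ∧
  (∑ w1 : W1, ∑ w2 : W2, |Pw PU Q (w1, w2) - freq w1n w2n w1 w2|) ≤ δ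

end Bset


section Aux

/-- Expectation. -/
noncomputable def Ex {α : Type*} [Fintype α] (p f : α → ℝ) : ℝ := ∑ a, p a * f a

/-- Product law. -/
noncomputable def piD {ι α : Type*} [Fintype ι] (p : ι → α → ℝ) (c : ι → α) : ℝ :=
  ∏ i, p i (c i)

/-- Law of a cloud centre with its satellites. -/
noncomputable def sD {X Y M : Type*} [Fintype M] (px : X → ℝ) (k : X → Y → ℝ)
    (z : X × (M → Y)) : ℝ := px z.1 * piD (fun _ => k z.1) z.2

lemma Ex_add {α : Type*} [Fintype α] (p f g : α → ℝ) :
    Ex p (fun a => f a + g a) = Ex p f + Ex p g := by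
  simp [Ex, mul_add, Finset.sum_add_distrib]

lemma Ex_sub {α : Type*} [Fintype α] (p f g : α → ℝ) :
    Ex p (fun a => f a - g a) = Ex p f - Ex p g := by
  simp [Ex, mul_sub, Finset.sum_sub_distrib]

lemma Ex_mul {α : Type*} [Fintype α] (p f : α → ℝ) (r : ℝ) :
    Ex p (fun a => r * f a) = r * Ex p f := by
  simp only [Ex, Finset.mul_sum]
  exact Finset.sum_congr rfl fun a _ => by ring

lemma Ex_sum {α ι : Type*} [Fintype α] (s : Finset ι) (p : α → ℝ) (f : ι → α → ℝ) :
    Ex p (fun a => ∑ i ∈ s, f i a) = ∑ i ∈ s, Ex p (f i) := by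
  simp only [Ex, Finset.mul_sum]
  exact Finset.sum_comm

lemma Ex_const {α : Type*} [Fintype α] {p : α → ℝ} (hp : IsDist p) (r : ℝ) :
    Ex p (fun _ => r) = r := by
  simp [Ex, ← Finset.sum_mul, hp.2]

lemma Ex_mono {α : Type*} [Fintype α] {p f g : α → ℝ} (hp : ∀ a, 0 ≤ p a)
    (h : ∀ a, f a ≤ g a) : Ex p f ≤ Ex p g :=
  Finset.sum_le_sum fun a _ => mul_le_mul_of_nonneg_left (h a) (hp a)

lemma Ex_nonneg {α : Type*} [Fintype α] {p f : α → ℝ} (hp : ∀ a, 0 ≤ p a)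
    (h : ∀ a, 0 ≤ f a) : 0 ≤ Ex p f :=
  Finset.sum_nonneg fun a _ => mul_nonneg (hp a) (h a)

lemma Ex_sq_le {α : Type*} [Fintype α] {p : α → ℝ} (hp : IsDist p) (f : α → ℝ) :
    (Ex p f) ^ 2 ≤ Ex p (fun a => f a ^ 2) := by
  have h : 0 ≤ Ex p (fun a => (f a - Ex p f) ^ 2) :=
    Ex_nonneg hp.1 fun a => sq_nonneg _
  have e : (fun a => (f a - Ex p f) ^ 2) =
      fun a => (f a ^ 2 - (2 * Ex p f) * f a) + (Ex p f) ^ 2 := by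
    funext a; ring
  rw [e, Ex_add, Ex_sub, Ex_mul, Ex_const hp] at h
  nlinarith

lemma Ex_abs_le {α : Type*} [Fintype α] {p : α → ℝ} (hp : IsDist p) (f : α → ℝ) (B : ℝ)
    (h : Ex p (fun a => f a ^ 2) ≤ B) :
    Ex p (fun a => |f a|) ≤ Real.sqrt B := by
  apply Real.le_sqrt_of_sq_le
  refine (Ex_sq_le hp _).trans ?_
  simpa using h

lemma exists_le_Ex {α : Type*} [Fintype α] {p : α → ℝ} (hp : IsDist p) (f : α → ℝ) :
    ∃ a, f a ≤ Ex p f := by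
  by_contra! h
  have hne : ∃ a, 0 < p a := by
    by_contra! h'
    have : ∑ a, p a ≤ 0 := Finset.sum_nonpos fun a _ => h' a
    rw [hp.2] at this; linarith
  obtain ⟨a0, ha0⟩ := hne
  have h1 : ∑ a, p a * Ex p f < ∑ a, p a * f a :=
    Finset.sum_lt_sum (fun a _ => mul_le_mul_of_nonneg_left (h a).le (hp.1 a))
      ⟨a0, Finset.mem_univ _, mul_lt_mul_of_pos_left (h a0) ha0⟩
  rw [← Finset.sum_mul, hp.2, one_mul] at h1
  exact lt_irrefl _ h1

lemma piD_ex_prod {ι α : Type*} [Fintype ι] [DecidableEq ι] [Fintype α] (p : ι → α → ℝ)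
    (h : ι → α → ℝ) :
    Ex (piD p) (fun c => ∏ i, h i (c i)) = ∏ i, Ex (p i) (h i) := by
  classical
  simp only [Ex, piD, ← Finset.prod_mul_distrib]
  rw [Finset.prod_univ_sum, Fintype.piFinset_univ]

lemma piD_dist {ι α : Type*} [Fintype ι] [DecidableEq ι] [Fintype α] {p : ι → α → ℝ}
    (hp : ∀ i, IsDist (p i)) : IsDist (piD p) := by
  refine ⟨fun c => Finset.prod_nonneg fun i _ => (hp i).1 _, ?_⟩
  have := piD_ex_prod p (fun _ _ => 1)
  simpa [Ex, (hp _).2] using this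

lemma piD_marg {ι α : Type*} [Fintype ι] [DecidableEq ι] [Fintype α] {p : ι → α → ℝ}
    (hp : ∀ i, IsDist (p i)) (i : ι) (f : α → ℝ) :
    Ex (piD p) (fun c => f (c i)) = Ex (p i) f := by
  have := piD_ex_prod p (fun j a => if j = i then f a else 1)
  rw [Finset.prod_eq_single i] at this
  · simpa using this
  · intro j _ hj
    simp [hj, Ex, (hp _).2]
  · simp

lemma piD_pair {ι α : Type*} [Fintype ι] [DecidableEq ι] [Fintype α] {p : ι → α → ℝ}
    (hp : ∀ i, IsDist (p i)) {i j : ι} (hij : i ≠ j) (f g : α → ℝ) :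
    Ex (piD p) (fun c => f (c i) * g (c j)) = Ex (p i) f * Ex (p j) g := by
  have := piD_ex_prod p (fun l a => (if l = i then f a else 1) * (if l = j then g a else 1))
  simp only [Finset.prod_mul_distrib, Finset.prod_ite_eq', Finset.mem_univ, if_true] at this
  rw [this, Finset.prod_eq_mul i j hij]
  · simp [hij, hij.symm]
  · intro l _ hl
    simp [hl.1, hl.2, Ex, (hp _).2]
  · simp
  · simp

lemma var_avg {ι α : Type*} [Fintype ι] [DecidableEq ι] [Nonempty ι] [Fintype α] {p : α → ℝ}
    (hp : IsDist p) (f : α → ℝ) :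
    Ex (piD (fun _ : ι => p)) (fun c => ((Fintype.card ι : ℝ)⁻¹ * ∑ i, f (c i) - Ex p f) ^ 2)
      ≤ (Fintype.card ι : ℝ)⁻¹ * Ex p (fun a => f a ^ 2) := by
  set N : ℝ := (Fintype.card ι : ℝ) with hN
  have hN0 : 0 < N := by rw [hN]; exact_mod_cast Fintype.card_pos
  set g : α → ℝ := fun a => f a - Ex p f with hg
  have hg0 : Ex p g = 0 := by rw [hg, Ex_sub, Ex_const hp]; ring
  have e : (fun c : ι → α => (N⁻¹ * ∑ i, f (c i) - Ex p f) ^ 2) =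
      fun c => (N⁻¹) ^ 2 * ∑ i, ∑ j, g (c i) * g (c j) := by
    funext c
    rw [← Finset.sum_mul_sum, ← pow_two, ← mul_pow]
    congr 1
    simp only [hg, Finset.sum_sub_distrib, Finset.sum_const, Finset.card_univ, nsmul_eq_mul]
    rw [← hN]
    field_simp
  rw [e, Ex_mul, Ex_sum]
  have hgv : Ex p (fun a => g a ^ 2) ≤ Ex p (fun a => f a ^ 2) := by
    have e : (fun a => g a ^ 2) =
        fun a => (f a ^ 2 - (2 * Ex p f) * f a) + (Ex p f) ^ 2 := by
      funext a; simp only [hg]; ring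
    rw [e, Ex_add, Ex_sub, Ex_mul, Ex_const hp]
    nlinarith [sq_nonneg (Ex p f)]
  have h1 : ∀ i : ι, Ex (piD (fun _ : ι => p)) (fun c => ∑ j, g (c i) * g (c j)) =
      Ex p (fun a => g a ^ 2) := by
    intro i
    rw [Ex_sum, Finset.sum_eq_single i]
    · rw [← piD_marg (p := fun _ : ι => p) (fun _ => hp) i (fun a => g a ^ 2)]
      congr 1; funext c; ring
    · intro j _ hj
      rw [piD_pair (fun _ => hp) hj.symm, hg0]; ring
    · simp
  simp only [h1, Finset.sum_const, Finset.card_univ, nsmul_eq_mul]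
  rw [← hN, show N⁻¹ ^ 2 * (N * Ex p fun a => g a ^ 2) = N⁻¹ * Ex p fun a => g a ^ 2 by
    field_simp]
  exact mul_le_mul_of_nonneg_left hgv (by positivity)

lemma l1_avg {ι α : Type*} [Fintype ι] [DecidableEq ι] [Nonempty ι] [Fintype α] {p : α → ℝ}
    (hp : IsDist p) (f : α → ℝ) :
    Ex (piD (fun _ : ι => p)) (fun c => |(Fintype.card ι : ℝ)⁻¹ * ∑ i, f (c i) - Ex p f|)
      ≤ Real.sqrt ((Fintype.card ι : ℝ)⁻¹ * Ex p (fun a => f a ^ 2)) :=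
  Ex_abs_le (piD_dist fun _ => hp) _ _ (var_avg hp f)

lemma Ex_sD {X Y M : Type*} [Fintype M] [DecidableEq M] [Fintype X] [Fintype Y] (px : X → ℝ)
    (k : X → Y → ℝ) (F : X × (M → Y) → ℝ) :
    Ex (sD px k) F = Ex px (fun x => Ex (piD (fun _ : M => k x)) (fun y => F (x, y))) := by
  simp only [Ex, sD, Fintype.sum_prod_type, Finset.mul_sum, mul_assoc]

lemma sD_dist {X Y M : Type*} [Fintype M] [DecidableEq M] [Fintype X] [Fintype Y] {px : X → ℝ}
    {k : X → Y → ℝ} (hpx : IsDist px) (hk : ∀ x, IsDist (k x)) :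
    IsDist (sD (M := M) px k) := by
  refine ⟨fun z => mul_nonneg (hpx.1 _) ((piD_dist fun _ => hk _).1 _), ?_⟩
  have := Ex_sD (M := M) px k (fun _ => 1)
  simp only [Ex_const (piD_dist fun _ => hk _), Ex_const hpx] at this
  simpa [Ex] using this

/-- Expectation of a codebook average. -/
lemma code_avg {X Y M1 M2 : Type*} [Fintype M1] [DecidableEq M1] [Fintype M2] [DecidableEq M2]
    [Nonempty M1] [Nonempty M2]
    [Fintype X] [Fintype Y] {px : X → ℝ}
    {k : X → Y → ℝ} (hpx : IsDist px) (hk : ∀ x, IsDist (k x)) (h : X → Y → ℝ) :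
    Ex (piD (fun _ : M2 => sD (M := M1) px k)) (fun c => (Fintype.card M2 : ℝ)⁻¹ *
      ∑ m2, ((Fintype.card M1 : ℝ)⁻¹ * ∑ m1, h (c m2).1 ((c m2).2 m1))) =
      Ex px (fun x => Ex (k x) (h x)) := by
  have h2 : (Fintype.card M2 : ℝ) ≠ 0 := by exact_mod_cast Fintype.card_ne_zero
  have h1 : (Fintype.card M1 : ℝ) ≠ 0 := by exact_mod_cast Fintype.card_ne_zero
  rw [Ex_mul, Ex_sum]
  have : ∀ m2 : M2, Ex (piD (fun _ : M2 => sD (M := M1) px k))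
      (fun c => (Fintype.card M1 : ℝ)⁻¹ * ∑ m1, h (c m2).1 ((c m2).2 m1)) =
      Ex px (fun x => Ex (k x) (h x)) := by
    intro m2
    rw [piD_marg (p := fun _ : M2 => sD (M := M1) px k) (fun _ => sD_dist hpx hk) m2
      (fun z => (Fintype.card M1 : ℝ)⁻¹ * ∑ m1, h z.1 (z.2 m1)), Ex_sD]
    congr 1; funext x
    rw [Ex_mul, Ex_sum]
    simp only [piD_marg (p := fun _ : M1 => k x) (fun _ => hk x)]
    simp [h1]
  simp [this, h2]

lemma softcover {X Y A M1 M2 : Type*} [Fintype M1] [DecidableEq M1] [Fintype M2] [DecidableEq M2]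
    [Nonempty M1] [Nonempty M2] [Fintype X] [Fintype Y] [Fintype A] {px : X → ℝ}
    {k : X → Y → ℝ} (hpx : IsDist px) (hk : ∀ x, IsDist (k x))
    (v : X → Y → A → ℝ) (hv : ∀ x y a, 0 ≤ v x y a) (v2 : X → A → ℝ)
    (hv2 : ∀ x a, v2 x a = Ex (k x) (fun y => v x y a)) (pa : A → ℝ)
    (hpa : ∀ a, pa a = Ex px (fun x => v2 x a)) (hpa1 : ∑ a, pa a = 1)
    (T12 T2 β : ℝ) (hT12 : 0 ≤ T12) (hT2 : 0 ≤ T2)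
    (hβ : Ex px (fun x => Ex (k x) fun y => ∑ a, v x y a *
      (if v x y a ≤ T12 * pa a ∧ v2 x a ≤ T2 * pa a then 0 else 1)) ≤ β) :
    Ex (piD (fun _ : M2 => sD (M := M1) px k)) (fun c => ∑ a, |(Fintype.card M2 : ℝ)⁻¹ *
      ∑ m2, ((Fintype.card M1 : ℝ)⁻¹ * ∑ m1, v (c m2).1 ((c m2).2 m1) a) - pa a|) ≤
      Real.sqrt ((Fintype.card M2 : ℝ)⁻¹ * ((Fintype.card M1 : ℝ)⁻¹ * T12 + T2)) + 2 * β := by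
  set N2 : ℝ := (Fintype.card M2 : ℝ) with hN2
  set N1 : ℝ := (Fintype.card M1 : ℝ) with hN1
  have hN2p : 0 < N2 := by rw [hN2]; exact_mod_cast Fintype.card_pos
  have hN1p : 0 < N1 := by rw [hN1]; exact_mod_cast Fintype.card_pos
  have hD := piD_dist (ι := M2) (fun _ => sD_dist (M := M1) hpx hk)
  set D := piD (fun _ : M2 => sD (M := M1) px k) with hDdef
  have hv2n : ∀ x a, 0 ≤ v2 x a := fun x a => by
    rw [hv2]; exact Ex_nonneg (hk x).1 fun y => hv _ _ _
  have hpan : ∀ a, 0 ≤ pa a := fun a => by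
    rw [hpa]; exact Ex_nonneg hpx.1 fun y => hv2n _ _
  set b : X → Y → A → ℝ := fun x y a =>
    if v x y a ≤ T12 * pa a ∧ v2 x a ≤ T2 * pa a then 0 else 1 with hb
  set h : A → X → Y → ℝ := fun a x y => v x y a * b x y a with hh
  set g : A → X → Y → ℝ := fun a x y => v x y a * (1 - b x y a) with hg
  have hb01 : ∀ x y a, 0 ≤ b x y a ∧ b x y a ≤ 1 := by
    intro x y a; simp only [hb]; split_ifs <;> norm_num
  have hhn : ∀ a x y, 0 ≤ h a x y := fun a x y => mul_nonneg (hv _ _ _) (hb01 _ _ _).1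
  have hgn : ∀ a x y, 0 ≤ g a x y := fun a x y =>
    mul_nonneg (hv _ _ _) (by linarith [(hb01 x y a).2])
  have hgv : ∀ a x y, g a x y ≤ v x y a := fun a x y => by
    have := mul_nonneg (hv x y a) (hb01 x y a).1
    simp only [hg]; linarith
  set EE : (X → Y → ℝ) → ℝ := fun f => Ex px (fun x => Ex (k x) (f x)) with hEE
  have hpaEE : ∀ a, pa a = EE (g a) + EE (h a) := by
    intro a
    rw [hpa]
    simp only [hEE]
    rw [← Ex_add]
    congr 1; funext x
    rw [← Ex_add, hv2]
    congr 1; funext y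
    simp only [hg, hh]; ring
  set av : (X → Y → ℝ) → (M2 → X × (M1 → Y)) → ℝ := fun f c => N2⁻¹ *
      ∑ m2, (N1⁻¹ * ∑ m1, f (c m2).1 ((c m2).2 m1)) with hav
  have hEav : ∀ f, Ex D (av f) = EE f := fun f => code_avg hpx hk f
  have havadd : ∀ a c, N2⁻¹ * ∑ m2, (N1⁻¹ * ∑ m1, v (c m2).1 ((c m2).2 m1) a) =
      av (g a) c + av (h a) c := by
    intro a c
    simp only [hav]
    rw [← mul_add, ← Finset.sum_add_distrib]
    congr 1; refine Finset.sum_congr rfl fun m2 _ => ?_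
    rw [← mul_add, ← Finset.sum_add_distrib]
    congr 1; refine Finset.sum_congr rfl fun m1 _ => ?_
    simp only [hg, hh]; ring
  have havh : ∀ a c, 0 ≤ av (h a) c := by
    intro a c
    simp only [hav]
    exact mul_nonneg (by positivity) (Finset.sum_nonneg fun _ _ => mul_nonneg (by positivity)
      (Finset.sum_nonneg fun _ _ => hhn _ _ _))
  have hEh : ∀ a, 0 ≤ EE (h a) := fun a =>
    Ex_nonneg hpx.1 fun x => Ex_nonneg (hk x).1 fun y => hhn _ _ _
  have hEg : ∀ a, EE (g a) ≤ pa a := fun a => by rw [hpaEE]; linarith [hEh a]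
  -- second moment of `g`
  have hg2 : ∀ a, EE (fun x y => g a x y ^ 2) ≤ T12 * pa a ^ 2 := by
    intro a
    have : EE (fun x y => g a x y ^ 2) ≤ EE (fun x y => (T12 * pa a) * g a x y) := by
      refine Ex_mono hpx.1 fun x => Ex_mono (hk x).1 fun y => ?_
      show g a x y ^ 2 ≤ (T12 * pa a) * g a x y
      rw [pow_two]
      refine mul_le_mul_of_nonneg_right ?_ (hgn _ _ _)
      simp only [hg, hb]
      split_ifs with hc
      · simpa using hc.1
      · simpa using mul_nonneg hT12 (hpan a)
    refine this.trans ?_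
    simp only [hEE, Ex_mul]
    have := mul_le_mul_of_nonneg_left (hEg a) (mul_nonneg hT12 (hpan a))
    simp only [hEE] at this
    nlinarith
  have hg3 : ∀ a, Ex px (fun x => (Ex (k x) (g a x)) ^ 2) ≤ T2 * pa a ^ 2 := by
    intro a
    have : Ex px (fun x => (Ex (k x) (g a x)) ^ 2) ≤ Ex px (fun x => (T2 * pa a) * v2 x a) := by
      refine Ex_mono hpx.1 fun x => ?_
      have hle : Ex (k x) (g a x) ≤ v2 x a := by
        rw [hv2]; exact Ex_mono (hk x).1 fun y => hgv _ _ _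
      have hnn : 0 ≤ Ex (k x) (g a x) := Ex_nonneg (hk x).1 fun y => hgn _ _ _
      have hle2 : Ex (k x) (g a x) ≤ T2 * pa a := by
        by_cases hc : v2 x a ≤ T2 * pa a
        · exact hle.trans hc
        · have : g a x = fun _ => 0 := by
            funext y; simp only [hg, hb]; simp [hc]
          rw [this, Ex_const (hk x)]
          exact mul_nonneg hT2 (hpan a)
      rw [pow_two]
      exact mul_le_mul hle2 hle hnn (mul_nonneg hT2 (hpan a))
    refine this.trans ?_
    rw [Ex_mul, ← hpa]
    nlinarith
  -- variance
  have hvar : ∀ a, Ex D (fun c => (av (g a) c - EE (g a)) ^ 2) ≤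
      N2⁻¹ * (N1⁻¹ * T12 + T2) * pa a ^ 2 := by
    intro a
    have hs := sD_dist (M := M1) hpx hk
    set F : X × (M1 → Y) → ℝ := fun z => N1⁻¹ * ∑ m1, g a z.1 (z.2 m1) with hF
    have hEF : Ex (sD (M := M1) px k) F = EE (g a) := by
      rw [Ex_sD]; simp only [hEE]; congr 1; funext x
      simp only [hF]
      rw [Ex_mul, Ex_sum]
      simp only [piD_marg (p := fun _ : M1 => k x) (fun _ => hk x)]
      simp [hN1]
    have h1 := var_avg (ι := M2) hs F
    rw [hEF] at h1
    refine h1.trans ?_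
    rw [mul_assoc]
    refine mul_le_mul_of_nonneg_left ?_ (by positivity)
    rw [Ex_sD]
    have h2 : ∀ x, Ex (piD (fun _ : M1 => k x)) (fun y => F (x, y) ^ 2) ≤
        N1⁻¹ * Ex (k x) (fun y => g a x y ^ 2) + (Ex (k x) (g a x)) ^ 2 := by
      intro x
      have hv := var_avg (ι := M1) (hk x) (g a x)
      have hd := piD_dist (ι := M1) (fun _ => hk x)
      set μ := Ex (k x) (g a x)
      have hm : Ex (piD (fun _ : M1 => k x)) (fun y => F (x, y)) = μ := by
        simp only [hF]
        rw [Ex_mul, Ex_sum]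
        simp only [piD_marg (p := fun _ : M1 => k x) (fun _ => hk x)]
        simp [hN1, μ]
      have e : (fun y : M1 → Y => ((Fintype.card M1 : ℝ)⁻¹ * ∑ i, g a x (y i) - μ) ^ 2) =
          fun y => (F (x, y) ^ 2 - (2 * μ) * F (x, y)) + μ ^ 2 := by
        funext y; simp only [hF, hN1]; ring
      rw [e, Ex_add, Ex_sub, Ex_mul, Ex_const hd, hm] at hv
      nlinarith
    refine (Ex_mono hpx.1 h2).trans ?_
    rw [Ex_add, Ex_mul, add_mul, mul_assoc]
    exact add_le_add (mul_le_mul_of_nonneg_left (hg2 a) (by positivity)) (hg3 a)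
  have hper : ∀ a, Ex D (fun c => |N2⁻¹ * ∑ m2, (N1⁻¹ * ∑ m1, v (c m2).1 ((c m2).2 m1) a)
      - pa a|) ≤ Real.sqrt (N2⁻¹ * (N1⁻¹ * T12 + T2)) * pa a + 2 * EE (h a) := by
    intro a
    have h1 := Ex_abs_le hD _ _ (hvar a)
    rw [Real.sqrt_mul (by positivity), Real.sqrt_sq (hpan a)] at h1
    have h2 : Ex D (fun c => |N2⁻¹ * ∑ m2, (N1⁻¹ * ∑ m1, v (c m2).1 ((c m2).2 m1) a)
      - pa a|) ≤ Ex D (fun c => (|av (g a) c - EE (g a)| + av (h a) c) + EE (h a)) := by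
      refine Ex_mono hD.1 fun c => ?_
      rw [havadd, hpaEE a]
      have := havh a c
      have := hEh a
      have h3 : av (g a) c + av (h a) c - (EE (g a) + EE (h a)) =
        (av (g a) c - EE (g a)) + (av (h a) c - EE (h a)) := by ring
      rw [h3]
      refine (abs_add_le _ _).trans ?_
      have : |av (h a) c - EE (h a)| ≤ av (h a) c + EE (h a) := by
        rw [abs_le]; constructor <;> linarith
      linarith
    refine h2.trans ?_
    rw [Ex_add, Ex_add, Ex_const hD, hEav]
    linarith
  rw [Ex_sum]
  refine (Finset.sum_le_sum fun a _ => hper a).trans ?_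
  rw [Finset.sum_add_distrib, ← Finset.mul_sum, hpa1, mul_one, ← Finset.mul_sum]
  have : ∑ a, EE (h a) ≤ β := by
    refine le_trans (le_of_eq ?_) hβ
    simp only [hEE]
    rw [← Ex_sum]
    congr 1; funext x
    rw [← Ex_sum]
  linarith


open Filter Topology in
lemma kl_close {U : Type*} [Fintype U] (q : U → ℝ) (thr : ℝ) (ht : 0 < thr) :
    ∀ᶠ p in 𝓝 q, KL p q ≤ thr := by
  have hc : ContinuousAt (fun p : U → ℝ => KL p q) q := by
    unfold KL
    refine tendsto_finsetSum _ fun u _ => ?_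
    by_cases h : q u = 0
    · simp only [h, div_zero, Real.logb_zero, mul_zero]
      exact tendsto_const_nhds
    · have h1 : ContinuousAt (fun p : U → ℝ => p u) q := (continuous_apply u).continuousAt
      refine ContinuousAt.mul h1 ?_
      unfold Real.logb
      refine ContinuousAt.div_const (ContinuousAt.log (h1.div_const _) ?_) _
      simp [h]
  have h0 : KL q q = 0 := by
    unfold KL
    refine Finset.sum_eq_zero fun u _ => ?_
    by_cases h : q u = 0 <;> simp [h]
  have := hc.tendsto.eventually (gt_mem_nhds (show KL q q < thr by rw [h0]; exact ht))
  exact this.mono fun p hp => hp.le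

open Filter Topology in
lemma kl_fin {ι U : Type*} [Fintype U] [Finite ι] (q : ι → U → ℝ) (thr : ℝ) (ht : 0 < thr) :
    ∃ η > 0, ∀ i p, (∀ u, |p u - q i u| < η) → KL p (q i) ≤ thr := by
  have h1 : ∀ i, ∀ᶠ η in 𝓝[>] (0 : ℝ), ∀ p, (∀ u, |p u - q i u| < η) → KL p (q i) ≤ thr := by
    intro i
    obtain ⟨η, hη, h⟩ := Metric.eventually_nhds_iff.1 (kl_close (q i) thr ht)
    filter_upwards [Ioo_mem_nhdsGT hη] with e he p hp
    apply h
    refine (dist_pi_lt_iff hη).2 fun u => ?_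
    rw [Real.dist_eq]
    exact (hp u).trans he.2
  obtain ⟨η, h, hη⟩ := ((eventually_all.2 h1).and self_mem_nhdsWithin).exists
  exact ⟨η, hη, fun i p hp => h i p hp⟩

lemma bel_close {A U : Type*} [Fintype A] [Fintype U] [DecidableEq U] (P P' : A → ℝ)
    (hP : ∀ a, 0 ≤ P a) (φ : A → U) (V : U → ℝ) (hV : IsDist V) :
    ∑ u, (∑ a, P a) * |(∑ a, if φ a = u then P a else 0) / (∑ a, P a) - V u| ≤
      2 * ∑ a, |P a - P' a| +
      ∑ u, |(∑ a, if φ a = u then P' a else 0) - (∑ a, P' a) * V u| := by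
  have hS : 0 ≤ ∑ a, P a := Finset.sum_nonneg fun a _ => hP a
  have hu : ∀ u, (∑ a, P a) * |(∑ a, if φ a = u then P a else 0) / (∑ a, P a) - V u| ≤
      (∑ a, if φ a = u then |P a - P' a| else 0) + (∑ a, |P a - P' a|) * V u +
      |(∑ a, if φ a = u then P' a else 0) - (∑ a, P' a) * V u| := by
    intro u
    have h1 : (∑ a, P a) * |(∑ a, if φ a = u then P a else 0) / (∑ a, P a) - V u| =
        |(∑ a, if φ a = u then P a else 0) - (∑ a, P a) * V u| := by
      rcases eq_or_ne (∑ a, P a) 0 with h | h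
      · have h0 : ∀ a, P a = 0 := fun a =>
          (Finset.sum_eq_zero_iff_of_nonneg (fun a _ => hP a)).1 h a (Finset.mem_univ _)
        simp [h0]
      · conv_lhs => rw [← abs_of_nonneg hS]
        rw [← abs_mul, abs_of_nonneg hS, mul_sub, mul_div_cancel₀ _ h]
    rw [h1]
    have h2 : (∑ a, if φ a = u then P a else 0) - (∑ a, P a) * V u =
      (∑ a, if φ a = u then (P a - P' a) else 0) + (∑ a, (P' a - P a)) * V u +
        ((∑ a, if φ a = u then P' a else 0) - (∑ a, P' a) * V u) := by
      have : (∑ a, if φ a = u then (P a - P' a) else 0) =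
        (∑ a, if φ a = u then P a else 0) - ∑ a, if φ a = u then P' a else 0 := by
        rw [← Finset.sum_sub_distrib]
        exact Finset.sum_congr rfl fun a _ => by split_ifs <;> simp
      rw [this, Finset.sum_sub_distrib]; ring
    rw [h2]
    refine (abs_add_le _ _).trans (add_le_add ((abs_add_le _ _).trans (add_le_add ?_ ?_)) le_rfl)
    · refine (Finset.abs_sum_le_sum_abs _ _).trans (le_of_eq ?_)
      exact Finset.sum_congr rfl fun a _ => by split_ifs <;> simp
    · rw [abs_mul, abs_of_nonneg (hV.1 u)]
      refine mul_le_mul_of_nonneg_right ((Finset.abs_sum_le_sum_abs _ _).trans (le_of_eq ?_))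
        (hV.1 u)
      exact Finset.sum_congr rfl fun a _ => abs_sub_comm _ _
  refine (Finset.sum_le_sum fun u _ => hu u).trans ?_
  rw [Finset.sum_add_distrib, Finset.sum_add_distrib, ← Finset.mul_sum, hV.2, Finset.sum_comm]
  simp
  linarith

lemma exists_sigma {A M : Type*} [Fintype A] [Fintype M] [Nonempty M] (P : A → ℝ)
    (hP : ∀ a, 0 ≤ P a) (w : M → A → ℝ) (hw : ∀ m a, 0 ≤ w m a) :
    ∃ σ : A → M → ℝ, IsKernel σ ∧
      ∑ a, ∑ m, |P a * σ a m - w m a| = ∑ a, |(∑ m, w m a) - P a| := by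
  classical
  refine ⟨fun a m => if (∑ m, w m a) = 0 then (Fintype.card M : ℝ)⁻¹ else w m a / ∑ m, w m a,
    ?_, ?_⟩
  · intro a
    have hS : 0 ≤ ∑ m, w m a := Finset.sum_nonneg fun m _ => hw m a
    by_cases h : (∑ m, w m a) = 0
    · constructor
      · intro m; simp only [h, if_true]; positivity
      · simp [h]
    · constructor
      · intro m; simp only [h, if_false]; exact div_nonneg (hw m a) hS
      · simp only [h, if_false]; rw [← Finset.sum_div, div_self h]
  · refine Finset.sum_congr rfl fun a _ => ?_
    have hS : 0 ≤ ∑ m, w m a := Finset.sum_nonneg fun m _ => hw m a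
    by_cases h : (∑ m, w m a) = 0
    · have h0 : ∀ m, w m a = 0 := fun m =>
          (Finset.sum_eq_zero_iff_of_nonneg (fun m _ => hw m a)).1 h m (Finset.mem_univ _)
      have hc : (Fintype.card M : ℝ) ≠ 0 := by exact_mod_cast Fintype.card_ne_zero
      simp [h0, abs_of_nonneg (hP a)]
      field_simp
    · simp only [h, if_false]
      have : ∀ m, |P a * (w m a / ∑ m, w m a) - w m a| =
          w m a * (|(∑ m, w m a) - P a| / ∑ m, w m a) := by
        intro m
        have e : P a * (w m a / ∑ m, w m a) - w m a =
          (w m a / ∑ m, w m a) * (P a - ∑ m, w m a) := by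
          field_simp
        rw [e, abs_mul, abs_of_nonneg (div_nonneg (hw m a) hS), abs_sub_comm]
        ring
      simp only [this]
      rw [← Finset.sum_mul, mul_div_cancel₀ _ h]

lemma Ex_ind {α U : Type*} [Fintype α] [Fintype U] [DecidableEq U] (p : α → ℝ) (φ : α → U) (u : U) :
    Ex p (fun a => if φ a = u then 1 else 0) = ∑ a, if φ a = u then p a else 0 := by
  simp [Ex]

lemma piD_ind {n : ℕ} {U : Type*} [Fintype U] [DecidableEq U] {p : Fin n → U → ℝ}
    (hp : ∀ i, IsDist (p i)) (t : Fin n) (u : U) :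
    (∑ un : Fin n → U, if un t = u then piD p un else 0) = p t u := by
  have := piD_marg hp t (fun a => if a = u then (1 : ℝ) else 0)
  rw [Ex_ind (piD p) (fun un : Fin n → U => un t) u] at this
  rw [this]; simp [Ex]

open Classical in
lemma det_bound {U W1 W2 M1 M2 : Type*} [Fintype U] [Fintype W1] [Fintype W2] [Fintype M1]
    [Fintype M2] [Nonempty M1] [Nonempty M2] [DecidableEq U]
    (PU : U → ℝ) (hPU : IsDist PU) (Q : U → W1 × W2 → ℝ)
    (V : W1 × W2 → U → ℝ) (hV : IsKernel V) (V2 : W2 → U → ℝ) (hV2 : IsKernel V2)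
    (α γ δ η : ℝ) (hγ : 0 < γ) (hη : 0 < η)
    (hKL1 : ∀ w p, (∀ u, |p u - V w u| < η) → KL p (post PU Q w) ≤ α ^ 2 / (2 * Real.log 2))
    (hKL2 : ∀ w p, (∀ u, |p u - V2 w u| < η) → KL p (post2 PU Q w) ≤ α ^ 2 / (2 * Real.log 2))
    {n : ℕ} (hn : 0 < n) (σ : (Fin n → U) → M1 × M2 → ℝ) (hσ : IsKernel σ)
    (g1 : M1 × M2 → Fin n → W1) (g2 : M2 → Fin n → W2) (r : ℝ) (hr : 0 ≤ r) (D F B : ℝ)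
    (hD : ∑ un : Fin n → U, ∑ m1, ∑ m2,
      |Pn PU σ un m1 m2 - r * piD (fun t => V (g1 (m1, m2) t, g2 m2 t)) un| ≤ D)
    (hF : ∑ m1, ∑ m2, r * (if (∑ w1 : W1, ∑ w2 : W2,
      |Pw PU Q (w1, w2) - freq (g1 (m1, m2)) (g2 m2) w1 w2|) ≤ δ then 0 else 1) ≤ F)
    (hB : ∑ t, ∑ m2, ∑ u, |(∑ m1, r * V (g1 (m1, m2) t, g2 m2 t) u) -
        (∑ _m1 : M1, r) * V2 (g2 m2 t) u| ≤ B) :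
    1 - (D + F + (γ * n * η)⁻¹ * (n * (4 * D) + B)) ≤
      ∑ un : Fin n → U, ∑ m1, ∑ m2, Pn PU σ un m1 m2 *
          (if inB PU Q σ α γ δ m1 m2 (g1 (m1, m2)) (g2 m2) then (1 : ℝ) else 0) := by
  have hn' : (0 : ℝ) < n := by exact_mod_cast hn
  have hPn : ∀ un m1 m2, 0 ≤ Pn PU σ un m1 m2 := fun un m1 m2 =>
    mul_nonneg (Finset.prod_nonneg fun t _ => hPU.1 _) ((hσ un).1 _)
  have hp : ∀ m1 m2, 0 ≤ pMsg PU σ m1 m2 := fun m1 m2 => Finset.sum_nonneg fun un _ => hPn _ _ _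
  have htot : ∑ m1, ∑ m2, pMsg PU σ m1 m2 = 1 := by
    have : ∑ m1, ∑ m2, pMsg PU σ m1 m2 = ∑ un, (∏ t, PU (un t)) * ∑ m, σ un m := by
      simp only [pMsg, Pn, Finset.mul_sum, Fintype.sum_prod_type]
      rw [Finset.sum_comm' (t' := Finset.univ) (s' := fun _ => Finset.univ) (by simp)]
      conv_rhs => rw [Finset.sum_comm]
      rw [Finset.sum_comm]
      refine Finset.sum_congr rfl fun m1 _ => ?_
      rw [Finset.sum_comm]
    rw [this]
    simp only [(hσ _).2, mul_one]
    exact (piD_dist (ι := Fin n) (fun _ => hPU)).2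
  set fb : M1 → M2 → ℝ := fun m1 m2 => if (∑ w1 : W1, ∑ w2 : W2,
      |Pw PU Q (w1, w2) - freq (g1 (m1, m2)) (g2 m2) w1 w2|) ≤ δ then 0 else 1 with hfb
  set b1 : Fin n → M1 → M2 → ℝ := fun t m1 m2 =>
    ∑ u, |belief PU σ t m1 m2 u - V (g1 (m1, m2) t, g2 m2 t) u| with hb1
  set b2 : Fin n → M2 → ℝ := fun t m2 =>
    ∑ u, |belief2 PU σ t m2 u - V2 (g2 m2 t) u| with hb2
  have hb1n : ∀ t m1 m2, 0 ≤ b1 t m1 m2 := fun t m1 m2 => Finset.sum_nonneg fun _ _ => abs_nonneg _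
  have hb2n : ∀ t m2, 0 ≤ b2 t m2 := fun t m2 => Finset.sum_nonneg fun _ _ => abs_nonneg _
  have hpos : 0 < γ * n * η := by positivity
  -- pointwise bound
  have hpt : ∀ m1 m2, 1 - (fb m1 m2 + (γ * n * η)⁻¹ * ∑ t, (b1 t m1 m2 + b2 t m2)) ≤
      (if inB PU Q σ α γ δ m1 m2 (g1 (m1, m2)) (g2 m2) then (1 : ℝ) else 0) := by
    intro m1 m2
    have hsn : 0 ≤ ∑ t, (b1 t m1 m2 + b2 t m2) :=
      Finset.sum_nonneg fun t _ => add_nonneg (hb1n _ _ _) (hb2n _ _)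
    have hsn' : 0 ≤ (γ * n * η)⁻¹ * ∑ t, (b1 t m1 m2 + b2 t m2) :=
      mul_nonneg (by positivity) hsn
    have hfn : 0 ≤ fb m1 m2 := by simp only [hfb]; split_ifs <;> norm_num
    split_ifs with hin
    · linarith
    · unfold inB at hin
      rw [not_and_or] at hin
      rcases hin with hin | hin
      · push Not at hin
        rw [div_lt_iff₀ hn', Nat.card_eq_fintype_card, Fintype.card_subtype] at hin
        set G : Finset (Fin n) := Finset.univ.filter fun t =>
          max (KL (belief PU σ t m1 m2) (post PU Q (g1 (m1, m2) t, g2 m2 t)))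
          (KL (belief2 PU σ t m2) (post2 PU Q (g2 m2 t))) ≤ α ^ 2 / (2 * Real.log 2) with hG
        have hbad : ∀ t, t ∉ G → η ≤ b1 t m1 m2 + b2 t m2 := by
          intro t ht
          by_contra! hlt
          apply ht
          rw [hG, Finset.mem_filter]
          refine ⟨Finset.mem_univ _, max_le (hKL1 _ _ fun u => ?_) (hKL2 _ _ fun u => ?_)⟩
          · have : |belief PU σ t m1 m2 u - V (g1 (m1, m2) t, g2 m2 t) u| ≤ b1 t m1 m2 :=
              Finset.single_le_sum (f := fun u =>
                |belief PU σ t m1 m2 u - V (g1 (m1, m2) t, g2 m2 t) u|)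
                (fun _ _ => abs_nonneg _) (Finset.mem_univ u)
            linarith [hb2n t m2]
          · have : |belief2 PU σ t m2 u - V2 (g2 m2 t) u| ≤ b2 t m2 :=
              Finset.single_le_sum (f := fun u => |belief2 PU σ t m2 u - V2 (g2 m2 t) u|)
                (fun _ _ => abs_nonneg _) (Finset.mem_univ u)
            linarith [hb1n t m1 m2]
        have hcard : (Gᶜ.card : ℝ) = n - G.card := by
          have := Finset.card_add_card_compl G
          rw [Fintype.card_fin] at this
          rw [eq_sub_iff_add_eq, add_comm]; exact_mod_cast this
        have hle : (Gᶜ.card : ℝ) * η ≤ ∑ t, (b1 t m1 m2 + b2 t m2) := by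
          calc (Gᶜ.card : ℝ) * η = ∑ t ∈ Gᶜ, η := by simp
            _ ≤ ∑ t ∈ Gᶜ, (b1 t m1 m2 + b2 t m2) :=
              Finset.sum_le_sum fun t ht => hbad t (Finset.mem_compl.1 ht)
            _ ≤ _ := Finset.sum_le_univ_sum_of_nonneg fun t => add_nonneg (hb1n _ _ _) (hb2n _ _)
        have : γ * n * η ≤ ∑ t, (b1 t m1 m2 + b2 t m2) := by
          refine le_trans ?_ hle
          refine mul_le_mul_of_nonneg_right ?_ hη.le
          rw [hcard]
          have : (G.card : ℝ) ≤ (1 - γ) * n := hin.le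
          nlinarith
        have : 1 ≤ (γ * n * η)⁻¹ * ∑ t, (b1 t m1 m2 + b2 t m2) := by
          rw [← div_eq_inv_mul, le_div_iff₀ hpos]; linarith
        linarith
      · have : fb m1 m2 = 1 := by simp only [hfb]; rw [if_neg hin]
        linarith
  -- total variation on messages
  set d : M1 → M2 → ℝ := fun m1 m2 => ∑ un : Fin n → U,
    |Pn PU σ un m1 m2 - r * piD (fun t => V (g1 (m1, m2) t, g2 m2 t)) un| with hd
  have hdD : ∑ m1, ∑ m2, d m1 m2 ≤ D := by
    refine le_trans (le_of_eq ?_) hD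
    simp only [hd]
    conv_rhs => rw [Finset.sum_comm]
    refine Finset.sum_congr rfl fun m1 _ => ?_
    rw [Finset.sum_comm]
  have hsumV : ∀ m1 m2, ∑ un : Fin n → U, r * piD (fun t => V (g1 (m1, m2) t, g2 m2 t)) un = r := by
    intro m1 m2
    rw [← Finset.mul_sum, (piD_dist (ι := Fin n) (fun t => hV (g1 (m1, m2) t, g2 m2 t))).2, mul_one]
  have hmarg : ∀ m1 m2 t u, (∑ un : Fin n → U, if un t = u then
      r * piD (fun t => V (g1 (m1, m2) t, g2 m2 t)) un else 0) =
      r * V (g1 (m1, m2) t, g2 m2 t) u := by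
    intro m1 m2 t u
    rw [← piD_ind (fun t => hV (g1 (m1, m2) t, g2 m2 t)) t u, Finset.mul_sum]
    exact Finset.sum_congr rfl fun un _ => by split_ifs <;> simp
  have hpd : ∀ m1 m2, |pMsg PU σ m1 m2 - r| ≤ d m1 m2 := by
    intro m1 m2
    conv_lhs => rw [← hsumV m1 m2]
    rw [pMsg, ← Finset.sum_sub_distrib]
    exact Finset.abs_sum_le_sum_abs _ _
  have hf : ∑ m1, ∑ m2, pMsg PU σ m1 m2 * fb m1 m2 ≤ F + D := by
    calc ∑ m1, ∑ m2, pMsg PU σ m1 m2 * fb m1 m2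
        ≤ ∑ m1, ∑ m2, (r * fb m1 m2 + d m1 m2) := by
          refine Finset.sum_le_sum fun m1 _ => Finset.sum_le_sum fun m2 _ => ?_
          have h1 := (abs_le.1 (hpd m1 m2)).2
          have h0 : 0 ≤ d m1 m2 := (abs_nonneg _).trans (hpd m1 m2)
          simp only [hfb]; split_ifs
          · linarith
          · linarith
      _ ≤ F + D := by
        simp only [Finset.sum_add_distrib]; linarith
  have h1 : ∀ t, ∑ m1, ∑ m2, pMsg PU σ m1 m2 * b1 t m1 m2 ≤ 2 * D := by
    intro t
    calc ∑ m1, ∑ m2, pMsg PU σ m1 m2 * b1 t m1 m2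
        ≤ ∑ m1, ∑ m2, 2 * d m1 m2 := by
          refine Finset.sum_le_sum fun m1 _ => Finset.sum_le_sum fun m2 _ => ?_
          have := bel_close (fun un => Pn PU σ un m1 m2)
            (fun un => r * piD (fun t => V (g1 (m1, m2) t, g2 m2 t)) un)
            (fun un => hPn un m1 m2) (fun un => un t) (V (g1 (m1, m2) t, g2 m2 t)) (hV _)
          simp only [hmarg, hsumV, sub_self, abs_zero, Finset.sum_const_zero, add_zero] at this
          simp only [hb1, Finset.mul_sum]
          simp only [hd, Finset.mul_sum]
          rw [Finset.mul_sum] at this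
          exact this
      _ ≤ 2 * D := by simp only [← Finset.mul_sum]; linarith
  have h2 : ∑ t, ∑ m1, ∑ m2, pMsg PU σ m1 m2 * b2 t m2 ≤ n * (2 * D) + B := by
    have h2t : ∀ t, ∑ m1, ∑ m2, pMsg PU σ m1 m2 * b2 t m2 ≤ 2 * D +
        ∑ m2, ∑ u, |(∑ m1, r * V (g1 (m1, m2) t, g2 m2 t) u) -
        (∑ _m1 : M1, r) * V2 (g2 m2 t) u| := by
      intro t
      rw [Finset.sum_comm]
      have : ∀ m2, ∑ m1, pMsg PU σ m1 m2 * b2 t m2 ≤ 2 * ∑ m1, d m1 m2 +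
        ∑ u, |(∑ m1, r * V (g1 (m1, m2) t, g2 m2 t) u) -
        (∑ _m1 : M1, r) * V2 (g2 m2 t) u| := by
        intro m2
        have := bel_close (A := M1 × (Fin n → U)) (fun a => Pn PU σ a.2 a.1 m2)
            (fun a => r * piD (fun t => V (g1 (a.1, m2) t, g2 m2 t)) a.2)
            (fun a => hPn a.2 a.1 m2) (fun a => a.2 t) (V2 (g2 m2 t)) (hV2 _)
        simp only [Fintype.sum_prod_type, hmarg, hsumV] at this
        rw [← Finset.sum_mul]
        simp only [hb2, Finset.mul_sum]
        simp only [hd]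
        rw [Finset.mul_sum] at this
        simp only [Finset.mul_sum] at this ⊢
        exact this
      refine (Finset.sum_le_sum fun m2 _ => this m2).trans ?_
      rw [Finset.sum_add_distrib, ← Finset.mul_sum, Finset.sum_comm]
      linarith
    refine (Finset.sum_le_sum fun t _ => h2t t).trans ?_
    rw [Finset.sum_add_distrib]
    simp only [Finset.sum_const, Finset.card_univ, Fintype.card_fin, nsmul_eq_mul] at hB ⊢
    linarith
  have hfin : ∑ un : Fin n → U, ∑ m1, ∑ m2, Pn PU σ un m1 m2 *
          (if inB PU Q σ α γ δ m1 m2 (g1 (m1, m2)) (g2 m2) then (1 : ℝ) else 0) =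
      ∑ m1, ∑ m2, pMsg PU σ m1 m2 *
          (if inB PU Q σ α γ δ m1 m2 (g1 (m1, m2)) (g2 m2) then (1 : ℝ) else 0) := by
    rw [Finset.sum_comm]
    refine Finset.sum_congr rfl fun m1 _ => ?_
    rw [Finset.sum_comm]
    refine Finset.sum_congr rfl fun m2 _ => ?_
    rw [pMsg, Finset.sum_mul]
  rw [hfin]
  have hsw : ∑ m1, ∑ m2, pMsg PU σ m1 m2 * ∑ t, (b1 t m1 m2 + b2 t m2) =
      ∑ t, ∑ m1, ∑ m2, pMsg PU σ m1 m2 * b1 t m1 m2 +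
      ∑ t, ∑ m1, ∑ m2, pMsg PU σ m1 m2 * b2 t m2 := by
    rw [← Finset.sum_add_distrib]
    simp only [Finset.mul_sum, mul_add, ← Finset.sum_add_distrib]
    conv_rhs => rw [Finset.sum_comm]
    refine Finset.sum_congr rfl fun m1 _ => ?_
    rw [Finset.sum_comm]
  have h1s : ∑ t : Fin n, ∑ m1, ∑ m2, pMsg PU σ m1 m2 * b1 t m1 m2 ≤ n * (2 * D) := by
    refine (Finset.sum_le_sum fun t _ => h1 t).trans ?_
    simp
  have hlow : ∑ m1, ∑ m2, pMsg PU σ m1 m2 *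
      (1 - (fb m1 m2 + (γ * n * η)⁻¹ * ∑ t, (b1 t m1 m2 + b2 t m2))) =
      1 - (∑ m1, ∑ m2, pMsg PU σ m1 m2 * fb m1 m2 +
      (γ * n * η)⁻¹ * ∑ m1, ∑ m2, pMsg PU σ m1 m2 * ∑ t, (b1 t m1 m2 + b2 t m2)) := by
    conv_rhs => rw [← htot]
    simp only [Finset.mul_sum (a := (γ * n * η)⁻¹), ← Finset.sum_add_distrib,
      ← Finset.sum_sub_distrib]
    refine Finset.sum_congr rfl fun m1 _ => Finset.sum_congr rfl fun m2 _ => ?_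
    simp only [← Finset.mul_sum]
    ring
  have hmain := Finset.sum_le_sum fun m1 (_ : m1 ∈ (Finset.univ : Finset M1)) =>
    Finset.sum_le_sum fun m2 (_ : m2 ∈ (Finset.univ : Finset M2)) =>
      mul_le_mul_of_nonneg_left (hpt m1 m2) (hp m1 m2)
  rw [hlow, hsw] at hmain
  have : (γ * n * η)⁻¹ * (∑ t : Fin n, ∑ m1, ∑ m2, pMsg PU σ m1 m2 * b1 t m1 m2 +
      ∑ t, ∑ m1, ∑ m2, pMsg PU σ m1 m2 * b2 t m2) ≤ (γ * n * η)⁻¹ * (n * (4 * D) + B) :=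
    mul_le_mul_of_nonneg_left (by linarith) (by positivity)
  linarith


lemma Ex_mono' {α : Type*} [Fintype α] {p f g : α → ℝ} (hp : ∀ a, 0 ≤ p a)
    (h : ∀ a, 0 < p a → f a ≤ g a) : Ex p f ≤ Ex p g := by
  refine Finset.sum_le_sum fun a _ => ?_
  rcases (hp a).eq_or_lt with h0 | h0
  · simp [← h0]
  · exact mul_le_mul_of_nonneg_left (h a h0) (hp a)

lemma typ {Θ : Type*} [Fintype Θ] {q : Θ → ℝ} (hq : IsDist q) (a b : Θ → ℝ)
    (ha : ∀ z, 0 < q z → 0 < a z) (hb : ∀ z, 0 < b z) (τ : ℝ) (hτ : 0 < τ) {n : ℕ} (hn : 0 < n) :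
    Ex (piD (fun _ : Fin n => q)) (fun c => if ∏ t, a (c t) ≤
      (2 : ℝ) ^ ((n : ℝ) * (Ex q (fun z => Real.logb 2 (a z / b z)) + τ)) * ∏ t, b (c t)
      then 0 else 1) ≤
    Real.sqrt ((n : ℝ)⁻¹ * Ex q (fun z => Real.logb 2 (a z / b z) ^ 2)) / τ := by
  have : Nonempty (Fin n) := ⟨⟨0, hn⟩⟩
  have hn' : (0 : ℝ) < n := by exact_mod_cast hn
  set f : Θ → ℝ := fun z => Real.logb 2 (a z / b z) with hf
  have h1 := l1_avg (ι := Fin n) hq f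
  rw [Fintype.card_fin] at h1
  rw [le_div_iff₀ hτ, mul_comm, ← Ex_mul]
  refine le_trans (Ex_mono' (piD_dist (fun _ => hq)).1 fun c hc => ?_) h1
  split_ifs with hcond
  · simp
  · push Not at hcond
    have hqc : ∀ t, 0 < q (c t) := by
      intro t
      rcases (hq.1 (c t)).eq_or_lt with h0 | h0
      · exfalso
        have : piD (fun _ : Fin n => q) c = 0 := Finset.prod_eq_zero (Finset.mem_univ t) h0.symm
        linarith
      · exact h0
    have hbp : 0 < ∏ t, b (c t) := Finset.prod_pos fun t _ => hb _
    have hlt : (2 : ℝ) ^ ((n : ℝ) * (Ex q f + τ)) < ∏ t, (a (c t) / b (c t)) := by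
      rw [Finset.prod_div_distrib, lt_div_iff₀ hbp]; exact hcond
    have hlog := Real.logb_lt_logb (b := 2) (by norm_num) (by positivity) hlt
    rw [Real.logb_rpow (by norm_num) (by norm_num), Real.logb_prod _ _ (fun t _ =>
      (div_pos (ha _ (hqc t)) (hb _)).ne')] at hlog
    have : Ex q f + τ < (n : ℝ)⁻¹ * ∑ t, f (c t) := by
      rw [← div_eq_inv_mul, lt_div_iff₀ hn']; simp only [hf] at hlog ⊢; linarith
    rw [mul_one]
    exact le_trans (by linarith) (le_abs_self _)

/-- Triple law. -/
noncomputable def qT {U W1 W2 : Type*} (p2 : W2 → ℝ) (k1 : W2 → W1 → ℝ) (V : W1 × W2 → U → ℝ)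
    (z : W2 × W1 × U) : ℝ := p2 z.1 * (k1 z.1 z.2.1 * V (z.2.1, z.1) z.2.2)

lemma Ex_qT {U W1 W2 : Type*} [Fintype U] [Fintype W1] [Fintype W2]
    (p2 : W2 → ℝ) (k1 : W2 → W1 → ℝ) (V : W1 × W2 → U → ℝ) (f : W2 × W1 × U → ℝ) :
    Ex (qT p2 k1 V) f = Ex p2 (fun w2 => Ex (k1 w2) fun w1 => Ex (V (w1, w2)) fun u =>
      f (w2, w1, u)) := by
  simp only [Ex, qT, Fintype.sum_prod_type, Finset.mul_sum, mul_assoc]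

lemma qT_dist {U W1 W2 : Type*} [Fintype U] [Fintype W1] [Fintype W2]
    {p2 : W2 → ℝ} {k1 : W2 → W1 → ℝ} {V : W1 × W2 → U → ℝ} (hp2 : IsDist p2) (hk1 : IsKernel k1)
    (hV : IsKernel V) : IsDist (qT p2 k1 V) := by
  refine ⟨fun z => mul_nonneg (hp2.1 _) (mul_nonneg ((hk1 _).1 _) ((hV _).1 _)), ?_⟩
  have := Ex_qT p2 k1 V (fun _ => 1)
  simp only [Ex_const (hV _), Ex_const (hk1 _), Ex_const hp2] at this
  simpa [Ex] using this

lemma triple {U W1 W2 : Type*} [Fintype U] [Fintype W1] [Fintype W2] {n : ℕ}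
    (p2 : W2 → ℝ) (k1 : W2 → W1 → ℝ) (V : W1 × W2 → U → ℝ)
    (φ : (Fin n → W2) → (Fin n → W1) → (Fin n → U) → ℝ) :
    Ex (piD (fun _ : Fin n => p2)) (fun x => Ex (piD (fun t => k1 (x t))) fun y =>
      Ex (piD (fun t => V (y t, x t))) fun a => φ x y a) =
    Ex (piD (fun _ : Fin n => qT p2 k1 V))
      (fun c => φ (fun t => (c t).1) (fun t => (c t).2.1) (fun t => (c t).2.2)) := by
  let e : (Fin n → W2 × W1 × U) ≃ (Fin n → W2) × (Fin n → W1) × (Fin n → U) :=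
    { toFun := fun c => (fun t => (c t).1, fun t => (c t).2.1, fun t => (c t).2.2)
      invFun := fun d t => (d.1 t, d.2.1 t, d.2.2 t)
      left_inv := fun c => rfl
      right_inv := fun d => rfl }
  symm
  simp only [Ex, Finset.mul_sum]
  refine (Fintype.sum_equiv e _ (fun d => piD (fun _ : Fin n => qT p2 k1 V) (e.symm d) *
    φ d.1 d.2.1 d.2.2) (fun c => rfl)).trans ?_
  simp only [Fintype.sum_prod_type]
  refine Finset.sum_congr rfl fun x _ => Finset.sum_congr rfl fun y _ =>
    Finset.sum_congr rfl fun a _ => ?_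
  simp only [piD, qT, e, Equiv.coe_fn_symm_mk, Finset.prod_mul_distrib]
  ring

lemma mi_eq {α β : Type*} [Fintype α] [Fintype β] (p : α × β → ℝ) (hp : ∀ z, 0 ≤ p z) :
    miOfJoint p = ∑ a, ∑ b, p (a, b) *
      Real.logb 2 (p (a, b) / ((∑ b, p (a, b)) * ∑ a, p (a, b))) := by
  have h : ∀ a b, p (a, b) *
      Real.logb 2 (p (a, b) / ((∑ b, p (a, b)) * ∑ a, p (a, b))) =
      p (a, b) * Real.logb 2 (p (a, b)) - p (a, b) * Real.logb 2 (∑ b, p (a, b)) -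
       p (a, b) * Real.logb 2 (∑ a, p (a, b)) := by
    intro a b
    rcases (hp (a, b)).eq_or_lt with h0 | h0
    · simp [← h0]
    · have h1 : 0 < ∑ b, p (a, b) := lt_of_lt_of_le h0
        (Finset.single_le_sum (f := fun b => p (a, b)) (fun _ _ => hp _) (Finset.mem_univ b))
      have h2 : 0 < ∑ a, p (a, b) := lt_of_lt_of_le h0
        (Finset.single_le_sum (f := fun a => p (a, b)) (fun _ _ => hp _) (Finset.mem_univ a))
      rw [Real.logb_div h0.ne' (mul_pos h1 h2).ne', Real.logb_mul h1.ne' h2.ne']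
      ring
  simp only [h, Finset.sum_sub_distrib]
  rw [Finset.sum_comm (f := fun a b => p (a, b) * Real.logb 2 (∑ a, p (a, b)))]
  simp only [← Finset.sum_mul]
  simp only [miOfJoint, ent, Fintype.sum_prod_type]
  ring

lemma mi_chan {α β : Type*} [Fintype α] [Fintype β] (p : α × β → ℝ) (pw : β → ℝ) (v : β → α → ℝ)
    (hpw : ∀ b, 0 ≤ pw b) (hv : IsKernel v) (pa : α → ℝ) (hpa : ∀ a, pa a = Ex pw (fun b => v b a))
    (hp : ∀ a b, p (a, b) = pw b * v b a) :
    miOfJoint p = Ex pw (fun b => Ex (v b) fun a => Real.logb 2 (v b a / pa a)) := by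
  rw [mi_eq p (fun z => by rw [show z = (z.1, z.2) from rfl, hp]; exact mul_nonneg (hpw _) ((hv _).1 _)),
    Finset.sum_comm]
  simp only [Ex]
  refine Finset.sum_congr rfl fun b _ => ?_
  rw [Finset.mul_sum]
  refine Finset.sum_congr rfl fun a _ => ?_
  have h1 : ∑ b, p (a, b) = pa a := by rw [hpa]; simp only [hp, Ex]
  have h2 : ∑ a, p (a, b) = pw b := by simp only [hp, ← Finset.mul_sum, (hv b).2, mul_one]
  rw [h1, h2, hp]
  rcases eq_or_ne (pw b) 0 with h0 | h0
  · simp [h0]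
  · rw [mul_comm (pa a), mul_div_mul_left _ _ h0, mul_assoc]

lemma freq_eq {W1 W2 : Type*} [DecidableEq W1] [DecidableEq W2] {n : ℕ} (y : Fin n → W1)
    (x : Fin n → W2) (w1 : W1) (w2 : W2) :
    freq y x w1 w2 = (n : ℝ)⁻¹ * ∑ t, (if y t = w1 ∧ x t = w2 then (1 : ℝ) else 0) := by
  rw [freq, Nat.card_eq_fintype_card, Fintype.card_subtype, div_eq_inv_mul]
  simp

open Classical in
lemma freq_bound {U W1 W2 : Type*} [Fintype U] [Fintype W1] [Fintype W2]
    {p2 : W2 → ℝ} {k1 : W2 → W1 → ℝ} {V : W1 × W2 → U → ℝ} (hp2 : IsDist p2) (hk1 : IsKernel k1)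
    (hV : IsKernel V) (P : W1 × W2 → ℝ) (hP : ∀ w1 w2, P (w1, w2) = p2 w2 * k1 w2 w1)
    (δ : ℝ) (hδ : 0 < δ) {n : ℕ} (hn : 0 < n) :
    Ex (piD (fun _ : Fin n => p2)) (fun x => Ex (piD (fun t => k1 (x t))) fun y =>
      (if (∑ w1 : W1, ∑ w2 : W2, |P (w1, w2) - freq y x w1 w2|) ≤ δ then 0 else 1)) ≤
    (∑ w1 : W1, ∑ w2 : W2, Real.sqrt ((n : ℝ)⁻¹ * Ex (qT p2 k1 V) (fun z =>
      (if z.2.1 = w1 ∧ z.1 = w2 then (1 : ℝ) else 0) ^ 2))) / δ := by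
  have : Nonempty (Fin n) := ⟨⟨0, hn⟩⟩
  have hq := qT_dist hp2 hk1 hV
  have h0 := triple (n := n) p2 k1 V (fun x y _ =>
    (if (∑ w1 : W1, ∑ w2 : W2, |P (w1, w2) - freq y x w1 w2|) ≤ δ then 0 else 1))
  simp only [Ex_const (piD_dist fun _ => hV _)] at h0
  rw [h0, le_div_iff₀ hδ, mul_comm, ← Ex_mul]
  have hE : ∀ w1 w2, Ex (qT p2 k1 V) (fun z => if z.2.1 = w1 ∧ z.1 = w2 then (1 : ℝ) else 0) =
      P (w1, w2) := by
    intro w1 w2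
    rw [Ex_qT, hP]
    simp [Ex, ite_and, (hV _).2]
  calc _ ≤ Ex (piD (fun _ : Fin n => qT p2 k1 V)) (fun c => ∑ w1 : W1, ∑ w2 : W2,
        |(n : ℝ)⁻¹ * ∑ t, (if (c t).2.1 = w1 ∧ (c t).1 = w2 then (1 : ℝ) else 0) - P (w1, w2)|) := by
        refine Ex_mono (piD_dist fun _ => hq).1 fun c => ?_
        simp only [freq_eq, abs_sub_comm (P _)]
        split_ifs with hc
        · simp only [mul_zero]
          exact Finset.sum_nonneg fun _ _ => Finset.sum_nonneg fun _ _ => abs_nonneg _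
        · push Not at hc; linarith
    _ ≤ _ := by
        rw [Ex_sum]
        refine Finset.sum_le_sum fun w1 _ => ?_
        rw [Ex_sum]
        refine Finset.sum_le_sum fun w2 _ => ?_
        have := l1_avg (ι := Fin n) hq (fun z => if z.2.1 = w1 ∧ z.1 = w2 then (1 : ℝ) else 0)
        rw [hE, Fintype.card_fin] at this
        exact this

lemma B_bound {U W1 W2 M1 M2 : Type*} [Fintype U] [Fintype W1] [Fintype W2]
    [Fintype M1] [DecidableEq M1] [Fintype M2] [DecidableEq M2] [Nonempty M1] [Nonempty M2]
    {p2 : W2 → ℝ} {k1 : W2 → W1 → ℝ} {V : W1 × W2 → U → ℝ} (hp2 : IsDist p2) (hk1 : IsKernel k1)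
    (hV : IsKernel V) (V2 : W2 → U → ℝ)
    (hV2 : ∀ w2 u, V2 w2 u = Ex (k1 w2) (fun w1 => V (w1, w2) u)) {n : ℕ} (t : Fin n) :
    Ex (piD (fun _ : M2 => sD (M := M1) (piD (fun _ : Fin n => p2))
      (fun x : Fin n → W2 => piD (fun t => k1 (x t))))) (fun c => (Fintype.card M2 : ℝ)⁻¹ * ∑ m2, ∑ u,
        |(Fintype.card M1 : ℝ)⁻¹ * ∑ m1, V ((c m2).2 m1 t, (c m2).1 t) u - V2 ((c m2).1 t) u|) ≤
      Fintype.card U * Real.sqrt ((Fintype.card M1 : ℝ)⁻¹) := by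
  have hx := piD_dist (ι := Fin n) (fun _ => hp2)
  have hk : ∀ x : Fin n → W2, IsDist (piD (fun t => k1 (x t))) := fun x => piD_dist fun t => hk1 _
  have hs := sD_dist (M := M1) hx hk
  have h2 : (0 : ℝ) < Fintype.card M2 := by exact_mod_cast Fintype.card_pos
  have h1 : (0 : ℝ) < Fintype.card M1 := by exact_mod_cast Fintype.card_pos
  rw [Ex_mul, Ex_sum, ← div_eq_inv_mul, div_le_iff₀ h2]
  have : ∀ m2 : M2, Ex (piD (fun _ : M2 => sD (M := M1) (piD (fun _ : Fin n => p2))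
      (fun x : Fin n → W2 => piD (fun t => k1 (x t))))) (fun c => ∑ u,
        |(Fintype.card M1 : ℝ)⁻¹ * ∑ m1, V ((c m2).2 m1 t, (c m2).1 t) u - V2 ((c m2).1 t) u|) ≤
      Fintype.card U * Real.sqrt ((Fintype.card M1 : ℝ)⁻¹) := by
    intro m2
    rw [piD_marg (ι := M2) (fun _ => hs) m2 (fun z => ∑ u,
        |(Fintype.card M1 : ℝ)⁻¹ * ∑ m1, V (z.2 m1 t, z.1 t) u - V2 (z.1 t) u|), Ex_sD]
    rw [← Ex_const hx (Fintype.card U * Real.sqrt ((Fintype.card M1 : ℝ)⁻¹))]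
    refine Ex_mono hx.1 fun x => ?_
    rw [Ex_sum]
    have hu : ∀ u, Ex (piD (fun _ : M1 => piD (fun t => k1 (x t)))) (fun y =>
        |(Fintype.card M1 : ℝ)⁻¹ * ∑ m1, V (y m1 t, x t) u - V2 (x t) u|) ≤
        Real.sqrt ((Fintype.card M1 : ℝ)⁻¹) := by
      intro u
      have hl := l1_avg (ι := M1) (hk x) (fun y => V (y t, x t) u)
      rw [piD_marg (fun t => hk1 (x t)) t (fun w => V (w, x t) u), ← hV2] at hl
      refine hl.trans (Real.sqrt_le_sqrt ?_)
      refine mul_le_of_le_one_right (by positivity) ?_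
      rw [← Ex_const (hk x) 1]
      refine Ex_mono (hk x).1 fun y => ?_
      have ha := (hV (y t, x t)).1 u
      have hb : V (y t, x t) u ≤ 1 := by
        rw [← (hV (y t, x t)).2]
        exact Finset.single_le_sum (fun u _ => (hV (y t, x t)).1 u) (Finset.mem_univ u)
      nlinarith
    refine (Finset.sum_le_sum fun u _ => hu u).trans ?_
    simp
  refine (Finset.sum_le_sum fun m2 _ => this m2).trans ?_
  simp [mul_comm]

lemma D_bound {U W1 W2 M1 M2 : Type*} [Fintype U] [Fintype W1] [Fintype W2]
    [Fintype M1] [DecidableEq M1] [Fintype M2] [DecidableEq M2] [Nonempty M1] [Nonempty M2]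
    {p2 : W2 → ℝ} {k1 : W2 → W1 → ℝ} {V : W1 × W2 → U → ℝ} (hp2 : IsDist p2) (hk1 : IsKernel k1)
    (hV : IsKernel V) (V2 : W2 → U → ℝ)
    (hV2 : ∀ w2 u, V2 w2 u = Ex (k1 w2) (fun w1 => V (w1, w2) u))
    (PU : U → ℝ) (hPU : IsDist PU) (hPUpos : ∀ u, 0 < PU u)
    (hPUe : ∀ u, PU u = Ex p2 (fun w2 => V2 w2 u)) (I12 I2 τ : ℝ) (hτ : 0 < τ)
    (hI12 : I12 = Ex (qT p2 k1 V) (fun z => Real.logb 2 (V (z.2.1, z.1) z.2.2 / PU z.2.2)))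
    (hI2 : I2 = Ex (qT p2 k1 V) (fun z => Real.logb 2 (V2 z.1 z.2.2 / PU z.2.2)))
    {n : ℕ} (hn : 0 < n) :
    Ex (piD (fun _ : M2 => sD (M := M1) (piD (fun _ : Fin n => p2))
      (fun x : Fin n → W2 => piD (fun t => k1 (x t))))) (fun c => ∑ un : Fin n → U,
        |(Fintype.card M2 : ℝ)⁻¹ * ∑ m2, ((Fintype.card M1 : ℝ)⁻¹ * ∑ m1,
          piD (fun t => V ((c m2).2 m1 t, (c m2).1 t)) un) - piD (fun _ => PU) un|) ≤
      Real.sqrt ((Fintype.card M2 : ℝ)⁻¹ * ((Fintype.card M1 : ℝ)⁻¹ *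
        (2 : ℝ) ^ ((n : ℝ) * (I12 + τ)) + (2 : ℝ) ^ ((n : ℝ) * (I2 + τ)))) + 2 *
      (Real.sqrt ((n : ℝ)⁻¹ * Ex (qT p2 k1 V)
        (fun z => Real.logb 2 (V (z.2.1, z.1) z.2.2 / PU z.2.2) ^ 2)) / τ +
      Real.sqrt ((n : ℝ)⁻¹ * Ex (qT p2 k1 V)
        (fun z => Real.logb 2 (V2 z.1 z.2.2 / PU z.2.2) ^ 2)) / τ) := by
  have hq := qT_dist hp2 hk1 hV
  have hx := piD_dist (ι := Fin n) (fun _ => hp2)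
  have hk : ∀ x : Fin n → W2, IsDist (piD (fun t => k1 (x t))) := fun x => piD_dist fun t => hk1 _
  have hpos1 : ∀ z, 0 < qT p2 k1 V z → 0 < p2 z.1 ∧ 0 < k1 z.1 z.2.1 ∧ 0 < V (z.2.1, z.1) z.2.2 := by
    intro z hz
    have h1 := hp2.1 z.1
    have h2 := (hk1 z.1).1 z.2.1
    have h3 := (hV (z.2.1, z.1)).1 z.2.2
    refine ⟨lt_of_le_of_ne h1 fun h => ?_, lt_of_le_of_ne h2 fun h => ?_,
      lt_of_le_of_ne h3 fun h => ?_⟩ <;> simp [qT, ← h] at hz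
  have hpos2 : ∀ z, 0 < qT p2 k1 V z → 0 < V2 z.1 z.2.2 := by
    intro z hz
    obtain ⟨_, h2, h3⟩ := hpos1 z hz
    rw [hV2]
    exact lt_of_lt_of_le (mul_pos h2 h3) (Finset.single_le_sum
      (f := fun w1 => k1 z.1 w1 * V (w1, z.1) z.2.2)
      (fun w1 _ => mul_nonneg ((hk1 _).1 _) ((hV _).1 _)) (Finset.mem_univ z.2.1))
  refine softcover (A := Fin n → U) hx hk (fun x y => piD (fun t => V (y t, x t)))
    (fun x y a => (piD_dist fun t => hV _).1 a) (fun x => piD (fun t => V2 (x t))) ?_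
    (piD fun _ => PU) ?_ (piD_dist fun _ => hPU).2 _ _ _ (by positivity) (by positivity) ?_
  · intro x a
    simp only [piD, hV2]
    exact (piD_ex_prod (fun t => k1 (x t)) (fun t w => V (w, x t) (a t))).symm
  · intro a
    simp only [piD, hPUe]
    exact (piD_ex_prod (fun _ : Fin n => p2) (fun t w => V2 w (a t))).symm
  · have h0 := triple (n := n) p2 k1 V (fun x y a =>
      if piD (fun t => V (y t, x t)) a ≤ (2 : ℝ) ^ ((n : ℝ) * (I12 + τ)) * piD (fun _ => PU) a ∧
        piD (fun t => V2 (x t)) a ≤ (2 : ℝ) ^ ((n : ℝ) * (I2 + τ)) * piD (fun _ => PU) a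
      then 0 else 1)
    refine le_trans (le_of_eq h0) ?_
    have t1 := typ hq (fun z => V (z.2.1, z.1) z.2.2) (fun z => PU z.2.2)
      (fun z hz => (hpos1 z hz).2.2) (fun z => hPUpos _) τ hτ hn
    have t2 := typ hq (fun z => V2 z.1 z.2.2) (fun z => PU z.2.2)
      (fun z hz => hpos2 z hz) (fun z => hPUpos _) τ hτ hn
    rw [← hI12] at t1
    rw [← hI2] at t2
    refine le_trans ?_ (add_le_add t1 t2)
    rw [← Ex_add]
    refine Ex_mono (piD_dist fun _ => hq).1 fun c => ?_
    simp only [piD]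
    split_ifs with h h1 h2 h2 h1 h2 h2 <;> first | (norm_num; done) | exact absurd ⟨h1, h2⟩ h


lemma Ex_lin {α : Type*} [Fintype α] (p f g h : α → ℝ) (k m : ℝ) :
    Ex p (fun a => (f a + g a) + k * (m * (4 * f a) + h a)) =
      (Ex p f + Ex p g) + k * (m * (4 * Ex p f) + Ex p h) := by
  rw [Ex_add, Ex_add, Ex_mul, Ex_add, Ex_mul, Ex_mul]

open Classical in
lemma core {U W1 W2 M1 M2 : Type*} [Fintype U] [Fintype W1] [Fintype W2] [DecidableEq U]
    [Fintype M1] [DecidableEq M1] [Fintype M2] [DecidableEq M2] [Nonempty M1] [Nonempty M2]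
    {p2 : W2 → ℝ} {k1 : W2 → W1 → ℝ} {V : W1 × W2 → U → ℝ} (hp2 : IsDist p2) (hk1 : IsKernel k1)
    (hV : IsKernel V) (V2 : W2 → U → ℝ) (hV2k : IsKernel V2)
    (hV2 : ∀ w2 u, V2 w2 u = Ex (k1 w2) (fun w1 => V (w1, w2) u))
    (PU : U → ℝ) (hPU : IsDist PU) (Q : U → W1 × W2 → ℝ)
    (α γ δ η : ℝ) (hγ : 0 < γ) (hη : 0 < η)
    (hKL1 : ∀ w p, (∀ u, |p u - V w u| < η) → KL p (post PU Q w) ≤ α ^ 2 / (2 * Real.log 2))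
    (hKL2 : ∀ w p, (∀ u, |p u - V2 w u| < η) → KL p (post2 PU Q w) ≤ α ^ 2 / (2 * Real.log 2))
    {n : ℕ} (hn : 0 < n) (Dn Fn : ℝ)
    (hD : Ex (piD (fun _ : M2 => sD (M := M1) (piD (fun _ : Fin n => p2))
      (fun x : Fin n → W2 => piD (fun t => k1 (x t))))) (fun c => ∑ un : Fin n → U,
        |(Fintype.card M2 : ℝ)⁻¹ * ∑ m2, ((Fintype.card M1 : ℝ)⁻¹ * ∑ m1,
          piD (fun t => V ((c m2).2 m1 t, (c m2).1 t)) un) - piD (fun _ => PU) un|) ≤ Dn)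
    (hF : Ex (piD (fun _ : Fin n => p2)) (fun x => Ex (piD (fun t => k1 (x t))) fun y =>
      (if (∑ w1 : W1, ∑ w2 : W2, |Pw PU Q (w1, w2) - freq y x w1 w2|) ≤ δ then 0 else 1)) ≤ Fn) :
    ∃ σ : (Fin n → U) → M1 × M2 → ℝ, IsKernel σ ∧
    ∃ (g1 : M1 × M2 → Fin n → W1) (g2 : M2 → Fin n → W2),
      1 - (Dn + Fn + (γ * η)⁻¹ * (4 * Dn + Fintype.card U * Real.sqrt ((Fintype.card M1 : ℝ)⁻¹))) ≤
      ∑ un : Fin n → U, ∑ m1, ∑ m2, Pn PU σ un m1 m2 *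
          (if inB PU Q σ α γ δ m1 m2 (g1 (m1, m2)) (g2 m2) then (1 : ℝ) else 0) := by
  have hn' : (0 : ℝ) < n := by exact_mod_cast hn
  have hx := piD_dist (ι := Fin n) (fun _ => hp2)
  have hk : ∀ x : Fin n → W2, IsDist (piD (fun t => k1 (x t))) := fun x => piD_dist fun t => hk1 _
  have hs := sD_dist (M := M1) hx hk
  have hμ := piD_dist (ι := M2) (fun _ => hs)
  set μ := piD (fun _ : M2 => sD (M := M1) (piD (fun _ : Fin n => p2))
      (fun x : Fin n → W2 => piD (fun t => k1 (x t)))) with hμdef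
  set N1 : ℝ := (Fintype.card M1 : ℝ) with hN1
  set N2 : ℝ := (Fintype.card M2 : ℝ) with hN2
  have h2 : 0 < N2 := by rw [hN2]; exact_mod_cast Fintype.card_pos
  have h1 : 0 < N1 := by rw [hN1]; exact_mod_cast Fintype.card_pos
  let Dc : (M2 → (Fin n → W2) × (M1 → Fin n → W1)) → ℝ := fun c => ∑ un : Fin n → U,
        |N2⁻¹ * ∑ m2, (N1⁻¹ * ∑ m1,
          piD (fun t => V ((c m2).2 m1 t, (c m2).1 t)) un) - piD (fun _ => PU) un|
  let Fc : (M2 → (Fin n → W2) × (M1 → Fin n → W1)) → ℝ := fun c => N2⁻¹ * ∑ m2, (N1⁻¹ * ∑ m1,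
      (if (∑ w1 : W1, ∑ w2 : W2, |Pw PU Q (w1, w2) - freq ((c m2).2 m1) (c m2).1 w1 w2|) ≤ δ
        then 0 else 1))
  let Bc : (M2 → (Fin n → W2) × (M1 → Fin n → W1)) → ℝ := fun c => ∑ t, N2⁻¹ * ∑ m2, ∑ u,
        |N1⁻¹ * ∑ m1, V ((c m2).2 m1 t, (c m2).1 t) u - V2 ((c m2).1 t) u|
  have eF : Ex μ Fc ≤ Fn := by
    have := code_avg (M1 := M1) (M2 := M2) hx hk (fun x y =>
      (if (∑ w1 : W1, ∑ w2 : W2, |Pw PU Q (w1, w2) - freq y x w1 w2|) ≤ δ then 0 else 1))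
    exact this.trans_le hF
  have eB : Ex μ Bc ≤ n * (Fintype.card U * Real.sqrt (N1⁻¹)) := by
    rw [Ex_sum]
    refine (Finset.sum_le_sum fun t _ =>
      B_bound (M1 := M1) (M2 := M2) hp2 hk1 hV V2 hV2 t).trans ?_
    simp [hN1]
  obtain ⟨c, hc⟩ := exists_le_Ex hμ (fun c => (Dc c + Fc c) + (γ * n * η)⁻¹ *
    (n * (4 * Dc c) + Bc c))
  have hc2 : (Dc c + Fc c) + (γ * n * η)⁻¹ * (n * (4 * Dc c) + Bc c) ≤
      Dn + Fn + (γ * η)⁻¹ * (4 * Dn + Fintype.card U * Real.sqrt (N1⁻¹)) := by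
    refine hc.trans ?_
    rw [Ex_lin]
    have e : (γ * η)⁻¹ * (4 * Dn + Fintype.card U * Real.sqrt (N1⁻¹)) = (γ * n * η)⁻¹ *
      (n * (4 * Dn) + n * (Fintype.card U * Real.sqrt (N1⁻¹))) := by field_simp
    rw [e]
    change Ex μ Dc ≤ Dn at hD
    gcongr
  let g1 : M1 × M2 → Fin n → W1 := fun m => (c m.2).2 m.1
  let g2 : M2 → Fin n → W2 := fun m2 => (c m2).1
  obtain ⟨σ, hσ, hσe⟩ := exists_sigma (A := Fin n → U) (M := M1 × M2) (piD fun _ => PU)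
    (piD_dist fun _ => hPU).1 (fun m un => (N2⁻¹ * N1⁻¹) *
      piD (fun t => V (g1 m t, g2 m.2 t)) un)
    (fun m un => mul_nonneg (by positivity) ((piD_dist fun t => hV _).1 _))
  refine ⟨σ, hσ, g1, g2, ?_⟩
  refine le_trans (by linarith) (det_bound PU hPU Q V hV V2 hV2k α γ δ η hγ hη hKL1 hKL2 hn σ hσ
    g1 g2 (N2⁻¹ * N1⁻¹) (by positivity) (Dc c) (Fc c) (Bc c) ?_ ?_ ?_)
  · simp only [Fintype.sum_prod_type] at hσe
    refine le_of_eq (hσe.trans ?_)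
    refine Finset.sum_congr rfl fun un _ => ?_
    rw [Finset.sum_comm]
    simp only [Finset.mul_sum, g1, g2, mul_assoc]
  · rw [Finset.sum_comm]
    simp only [Fc, Finset.mul_sum, g1, g2, mul_assoc]
    exact le_rfl
  · refine le_of_eq (Finset.sum_congr rfl fun t _ => ?_)
    rw [Finset.mul_sum]
    refine Finset.sum_congr rfl fun m2 _ => ?_
    rw [Finset.mul_sum]
    refine Finset.sum_congr rfl fun u _ => ?_
    rw [← abs_of_pos (inv_pos.2 h2), ← abs_mul, abs_of_pos (inv_pos.2 h2), ← Finset.mul_sum]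
    congr 1
    simp only [Finset.sum_const, Finset.card_univ, nsmul_eq_mul, ← hN1, g1, g2]
    field_simp

lemma card_inv_le (R : ℝ) (n : ℕ) :
    ((Fintype.card (Msg R n) : ℝ))⁻¹ ≤ 2 * (2 : ℝ) ^ (-((n : ℝ) * R)) := by
  rw [Fintype.card_fin]
  push_cast
  rw [Real.rpow_neg (by norm_num), ← Real.rpow_natCast]
  have h := Nat.lt_floor_add_one ((n : ℝ) * R)
  have : (2 : ℝ) ^ ((n : ℝ) * R) ≤ 2 * (2 : ℝ) ^ ((⌊(n : ℝ) * R⌋₊ : ℝ)) := by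
    rw [mul_comm 2, ← Real.rpow_add_one (by norm_num)]
    exact Real.rpow_le_rpow_of_exponent_le (by norm_num) h.le
  have h1 : (0 : ℝ) < 2 ^ ((n : ℝ) * R) := by positivity
  have h2 : (0 : ℝ) < 2 ^ ((⌊(n : ℝ) * R⌋₊ : ℝ)) := by positivity
  rw [← div_eq_mul_inv, inv_eq_one_div, div_le_div_iff₀ h2 h1]
  linarith

open Filter Topology in
lemma exp_lim (R : ℝ) (hR : 0 < R) :
    Tendsto (fun n : ℕ => (2 : ℝ) ^ (-((n : ℝ) * R))) atTop (𝓝 0) := by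
  have : (fun n : ℕ => (2 : ℝ) ^ (-((n : ℝ) * R))) = fun n : ℕ => ((2 : ℝ) ^ (-R)) ^ n := by
    funext n
    rw [← Real.rpow_natCast, ← Real.rpow_mul (by norm_num)]
    congr 1; ring
  rw [this]
  exact tendsto_pow_atTop_nhds_zero_of_lt_one (by positivity)
    (Real.rpow_lt_one_of_one_lt_of_neg (by norm_num) (by linarith))

open Filter Topology in
lemma card_lim (R : ℝ) (hR : 0 < R) :
    Tendsto (fun n : ℕ => ((Fintype.card (Msg R n) : ℝ))⁻¹) atTop (𝓝 0) := by
  have h := (exp_lim R hR).const_mul 2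
  rw [mul_zero] at h
  exact squeeze_zero (fun n => by positivity) (fun n => card_inv_le R n) h

open Filter Topology in
lemma sq_lim (A : ℝ) : Tendsto (fun n : ℕ => Real.sqrt ((n : ℝ)⁻¹ * A)) atTop (𝓝 0) := by
  have h : Tendsto (fun n : ℕ => (n : ℝ)⁻¹ * A) atTop (𝓝 0) := by
    simpa using (tendsto_inv_atTop_nhds_zero_nat (𝕜 := ℝ)).mul_const A
  have h' := h.sqrt
  rwa [Real.sqrt_zero] at h'

open Filter Topology in
lemma D_lim (R1 R2 I12 I2 τ : ℝ) (hτ : 0 < τ)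
    (h12 : I12 + 2 * τ ≤ R1 + R2) (h2 : I2 + 2 * τ ≤ R2) :
    Tendsto (fun n : ℕ => Real.sqrt ((Fintype.card (Msg R2 n) : ℝ)⁻¹ *
      ((Fintype.card (Msg R1 n) : ℝ)⁻¹ * (2 : ℝ) ^ ((n : ℝ) * (I12 + τ)) +
        (2 : ℝ) ^ ((n : ℝ) * (I2 + τ))))) atTop (𝓝 0) := by
  have h : Tendsto (fun n : ℕ => (Fintype.card (Msg R2 n) : ℝ)⁻¹ *
      ((Fintype.card (Msg R1 n) : ℝ)⁻¹ * (2 : ℝ) ^ ((n : ℝ) * (I12 + τ)) +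
        (2 : ℝ) ^ ((n : ℝ) * (I2 + τ)))) atTop (𝓝 0) := by
    have h := (exp_lim τ hτ).const_mul 6
    rw [mul_zero] at h
    refine squeeze_zero (fun n => by positivity) (fun n => ?_) h
    have hn : (0 : ℝ) ≤ n := Nat.cast_nonneg n
    have a1 := card_inv_le R1 n
    have a2 := card_inv_le R2 n
    have b1 : (2 : ℝ) ^ (-((n : ℝ) * R2)) * ((2 : ℝ) ^ (-((n : ℝ) * R1)) *
        (2 : ℝ) ^ ((n : ℝ) * (I12 + τ))) ≤ (2 : ℝ) ^ (-((n : ℝ) * τ)) := by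
      rw [← Real.rpow_add (by norm_num), ← Real.rpow_add (by norm_num)]
      refine Real.rpow_le_rpow_of_exponent_le (by norm_num) ?_
      nlinarith
    have b2 : (2 : ℝ) ^ (-((n : ℝ) * R2)) * (2 : ℝ) ^ ((n : ℝ) * (I2 + τ)) ≤
        (2 : ℝ) ^ (-((n : ℝ) * τ)) := by
      rw [← Real.rpow_add (by norm_num)]
      refine Real.rpow_le_rpow_of_exponent_le (by norm_num) ?_
      nlinarith
    calc _ ≤ (2 * (2 : ℝ) ^ (-((n : ℝ) * R2))) * ((2 * (2 : ℝ) ^ (-((n : ℝ) * R1))) *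
          (2 : ℝ) ^ ((n : ℝ) * (I12 + τ)) + (2 : ℝ) ^ ((n : ℝ) * (I2 + τ))) := by gcongr
      _ = 4 * ((2 : ℝ) ^ (-((n : ℝ) * R2)) * ((2 : ℝ) ^ (-((n : ℝ) * R1)) *
        (2 : ℝ) ^ ((n : ℝ) * (I12 + τ)))) + 2 * ((2 : ℝ) ^ (-((n : ℝ) * R2)) *
          (2 : ℝ) ^ ((n : ℝ) * (I2 + τ))) := by ring
      _ ≤ _ := by linarith
  have h' := h.sqrt
  rwa [Real.sqrt_zero] at h'

open Filter Topology in
lemma tot_lim {U W1 W2 : Type*} [Fintype U] [Fintype W1] [Fintype W2]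
    (R1 R2 I12 I2 τ : ℝ) (hR1 : 0 < R1) (hτ : 0 < τ)
    (h12 : I12 + 2 * τ ≤ R1 + R2) (h2 : I2 + 2 * τ ≤ R2) (A B K δ c : ℝ) (C : W1 → W2 → ℝ) :
    Tendsto (fun n : ℕ =>
      (Real.sqrt ((Fintype.card (Msg R2 n) : ℝ)⁻¹ *
        ((Fintype.card (Msg R1 n) : ℝ)⁻¹ * (2 : ℝ) ^ ((n : ℝ) * (I12 + τ)) +
          (2 : ℝ) ^ ((n : ℝ) * (I2 + τ)))) + 2 * (Real.sqrt ((n : ℝ)⁻¹ * A) / τ +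
            Real.sqrt ((n : ℝ)⁻¹ * B) / τ)) +
      (∑ w1, ∑ w2, Real.sqrt ((n : ℝ)⁻¹ * C w1 w2)) / δ +
      K * (4 * (Real.sqrt ((Fintype.card (Msg R2 n) : ℝ)⁻¹ *
        ((Fintype.card (Msg R1 n) : ℝ)⁻¹ * (2 : ℝ) ^ ((n : ℝ) * (I12 + τ)) +
          (2 : ℝ) ^ ((n : ℝ) * (I2 + τ)))) + 2 * (Real.sqrt ((n : ℝ)⁻¹ * A) / τ +
            Real.sqrt ((n : ℝ)⁻¹ * B) / τ)) +
        c * Real.sqrt ((Fintype.card (Msg R1 n) : ℝ)⁻¹))) atTop (𝓝 0) := by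
  have hD := (D_lim R1 R2 I12 I2 τ hτ h12 h2).add
    ((((sq_lim A).div_const τ).add ((sq_lim B).div_const τ)).const_mul 2)
  have hF : Tendsto (fun n : ℕ => (∑ w1, ∑ w2, Real.sqrt ((n : ℝ)⁻¹ * C w1 w2)) / δ)
      atTop (𝓝 ((∑ _w1 : W1, ∑ _w2 : W2, (0 : ℝ)) / δ)) :=
    (tendsto_finsetSum _ fun w1 _ => tendsto_finsetSum _ fun w2 _ =>
      sq_lim (C w1 w2)).div_const δ
  have hB := ((Real.continuous_sqrt.tendsto 0).comp (card_lim R1 hR1)).const_mul c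
  have := (hD.add hF).add (((hD.const_mul 4).add hB).const_mul K)
  simpa using this

/-- Conditional law of `W1` given `W2`. -/
noncomputable def kk {U W1 W2 : Type*} [Fintype U] [Fintype W1] [Fintype W2]
    (PU : U → ℝ) (Q : U → W1 × W2 → ℝ) (w2 : W2) (w1 : W1) : ℝ :=
  open Classical in if Pw2 PU Q w2 = 0 then ∑ w2', Pw PU Q (w1, w2') else
    Pw PU Q (w1, w2) / Pw2 PU Q w2

/-- Totalised posterior. -/
noncomputable def vv {U W1 W2 : Type*} [Fintype U]
    (PU : U → ℝ) (Q : U → W1 × W2 → ℝ) (w : W1 × W2) (u : U) : ℝ :=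
  open Classical in if Pw PU Q w = 0 then PU u else post PU Q w u

section Fin
variable {U W1 W2 : Type*} [Fintype U] [Fintype W1] [Fintype W2]
  {PU : U → ℝ} {Q : U → W1 × W2 → ℝ}

lemma Pw_nonneg (hPU : IsDist PU) (hQ : IsKernel Q) (w : W1 × W2) : 0 ≤ Pw PU Q w :=
  Finset.sum_nonneg fun u _ => mul_nonneg (hPU.1 u) ((hQ u).1 w)

lemma Pw_sum (hPU : IsDist PU) (hQ : IsKernel Q) : ∑ w, Pw PU Q w = 1 := by
  simp only [Pw]
  rw [Finset.sum_comm]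
  simp only [← Finset.mul_sum, (hQ _).2, mul_one, hPU.2]

lemma Pw2_dist (hPU : IsDist PU) (hQ : IsKernel Q) : IsDist (Pw2 PU Q) := by
  refine ⟨fun w2 => Finset.sum_nonneg fun w1 _ => Pw_nonneg hPU hQ _, ?_⟩
  rw [← Pw_sum hPU hQ, Fintype.sum_prod_type_right]
  rfl

lemma kk_dist (hPU : IsDist PU) (hQ : IsKernel Q) : IsKernel (kk PU Q) := by
  intro w2
  by_cases h : Pw2 PU Q w2 = 0
  · refine ⟨fun w1 => ?_, ?_⟩
    · simp only [kk, h, if_true]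
      exact Finset.sum_nonneg fun _ _ => Pw_nonneg hPU hQ _
    · simp only [kk, h, if_true]
      rw [← Pw_sum hPU hQ, Fintype.sum_prod_type]
  · refine ⟨fun w1 => ?_, ?_⟩
    · simp only [kk, h, if_false]
      exact div_nonneg (Pw_nonneg hPU hQ _) ((Pw2_dist hPU hQ).1 _)
    · simp only [kk, h, if_false]
      rw [← Finset.sum_div]
      exact div_self h

lemma vv_dist (hPU : IsDist PU) (hQ : IsKernel Q) : IsKernel (vv PU Q) := by
  intro w
  by_cases h : Pw PU Q w = 0
  · have : vv PU Q w = PU := by funext u; simp [vv, h]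
    rw [this]; exact hPU
  · refine ⟨fun u => ?_, ?_⟩
    · simp only [vv, h, if_false, post]
      exact div_nonneg (mul_nonneg (hPU.1 u) ((hQ u).1 w)) (Pw_nonneg hPU hQ _)
    · simp only [vv, h, if_false, post]
      rw [← Finset.sum_div]
      exact div_self h

lemma Pw_eq (hPU : IsDist PU) (hQ : IsKernel Q) (w1 : W1) (w2 : W2) :
    Pw PU Q (w1, w2) = Pw2 PU Q w2 * kk PU Q w2 w1 := by
  by_cases h : Pw2 PU Q w2 = 0
  · rw [h, zero_mul]
    exact (Finset.sum_eq_zero_iff_of_nonneg (fun w1 _ => Pw_nonneg hPU hQ (w1, w2))).1 h w1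
      (Finset.mem_univ _)
  · simp only [kk, h, if_false]
    field_simp

lemma PQ_eq (hPU : IsDist PU) (hQ : IsKernel Q) (w : W1 × W2) (u : U) :
    PU u * Q u w = Pw PU Q w * vv PU Q w u := by
  by_cases h : Pw PU Q w = 0
  · rw [h, zero_mul]
    exact (Finset.sum_eq_zero_iff_of_nonneg
      (fun u _ => mul_nonneg (hPU.1 u) ((hQ u).1 w))).1 h u (Finset.mem_univ _)
  · simp only [vv, h, if_false, post]
    field_simp

/-- Totalised posterior given `W2`. -/
noncomputable def vv2 (PU : U → ℝ) (Q : U → W1 × W2 → ℝ) (w2 : W2) (u : U) : ℝ :=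
  Ex (kk PU Q w2) (fun w1 => vv PU Q (w1, w2) u)

lemma vv2_dist (hPU : IsDist PU) (hQ : IsKernel Q) : IsKernel (vv2 PU Q) := by
  intro w2
  refine ⟨fun u => Ex_nonneg (kk_dist hPU hQ w2).1 fun w1 => (vv_dist hPU hQ _).1 u, ?_⟩
  simp only [vv2]
  rw [← Ex_sum]
  simp only [(vv_dist hPU hQ _).2]
  exact Ex_const (kk_dist hPU hQ w2) 1

lemma PQ2_eq (hPU : IsDist PU) (hQ : IsKernel Q) (w2 : W2) (u : U) :
    ∑ w1, PU u * Q u (w1, w2) = Pw2 PU Q w2 * vv2 PU Q w2 u := by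
  simp only [vv2, Ex, Finset.mul_sum]
  refine Finset.sum_congr rfl fun w1 _ => ?_
  rw [PQ_eq hPU hQ, Pw_eq hPU hQ, mul_assoc]

lemma PU_eq (hPU : IsDist PU) (hQ : IsKernel Q) (u : U) :
    PU u = Ex (Pw2 PU Q) (fun w2 => vv2 PU Q w2 u) := by
  simp only [Ex, ← PQ2_eq hPU hQ]
  rw [← Fintype.sum_prod_type_right (f := fun w => PU u * Q u w), ← Finset.mul_sum, (hQ u).2, mul_one]

lemma mi2_eq (hPU : IsDist PU) (hQ : IsKernel Q) :
    miOfJoint (fun p : U × W2 => ∑ w1, PU p.1 * Q p.1 (w1, p.2)) =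
    Ex (qT (Pw2 PU Q) (kk PU Q) (vv PU Q)) (fun z => Real.logb 2 (vv2 PU Q z.1 z.2.2 / PU z.2.2)) := by
  rw [mi_chan _ (Pw2 PU Q) (vv2 PU Q) (Pw2_dist hPU hQ).1 (vv2_dist hPU hQ) PU (PU_eq hPU hQ)
    (fun u w2 => PQ2_eq hPU hQ w2 u), Ex_qT]
  congr 1
  funext w2
  simp only [Ex, vv2, Finset.mul_sum, Finset.sum_mul]
  rw [Finset.sum_comm]
  simp only [mul_assoc]

lemma mi12_eq (hPU : IsDist PU) (hQ : IsKernel Q) :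
    miOfJoint (fun p : U × (W1 × W2) => PU p.1 * Q p.1 p.2) =
    Ex (qT (Pw2 PU Q) (kk PU Q) (vv PU Q))
      (fun z => Real.logb 2 (vv PU Q (z.2.1, z.1) z.2.2 / PU z.2.2)) := by
  rw [mi_chan _ (Pw PU Q) (vv PU Q) (Pw_nonneg hPU hQ) (vv_dist hPU hQ) PU ?_
    (fun u w => PQ_eq hPU hQ w u), Ex_qT]
  · rw [Ex, Fintype.sum_prod_type_right, Ex]
    refine Finset.sum_congr rfl fun w2 _ => ?_
    rw [Ex, Finset.mul_sum]
    refine Finset.sum_congr rfl fun w1 _ => ?_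
    rw [Pw_eq hPU hQ, mul_assoc]
  · intro u
    simp only [Ex, ← PQ_eq hPU hQ]
    rw [← Finset.mul_sum, (hQ u).2, mul_one]

lemma kl_eta (hPU : IsDist PU) (hQ : IsKernel Q) (thr : ℝ) (ht : 0 < thr) :
    ∃ η > 0, (∀ w p, (∀ u, |p u - vv PU Q w u| < η) → KL p (post PU Q w) ≤ thr) ∧
      (∀ w p, (∀ u, |p u - vv2 PU Q w u| < η) → KL p (post2 PU Q w) ≤ thr) := by
  obtain ⟨a, ha, h1⟩ := kl_fin (vv PU Q) thr ht
  obtain ⟨b, hb, h2⟩ := kl_fin (vv2 PU Q) thr ht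
  refine ⟨min a b, lt_min ha hb, fun w p hp => ?_, fun w p hp => ?_⟩
  · by_cases h : Pw PU Q w = 0
    · simp [KL, post, h, ht.le]
    · have := h1 w p (fun u => (hp u).trans_le (min_le_left _ _))
      have e : vv PU Q w = post PU Q w := by funext u; simp [vv, h]
      rwa [e] at this
  · by_cases h : Pw2 PU Q w = 0
    · simp [KL, post2, h, ht.le]
    · have := h2 w p (fun u => (hp u).trans_le (min_le_right _ _))
      have e : vv2 PU Q w = post2 PU Q w := by
        funext u; rw [post2, PQ2_eq hPU hQ]; field_simp
      rwa [e] at this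

end Fin

end Aux

open Classical in
/-- if `Q_{W1W2|U} ∈ Q̃0(R1,R2)` (strict information constraints
and singleton worst-case action set), then for all `ε, α, γ > 0` there exists
`δ̄ > 0` such that for all `0 < δ ≤ δ̄` there exists `n̄` such that for all
`n ≥ n̄` there exist an encoding strategy `σ` and deterministic codeword maps
`g1, g2` with `P^σ((M1,M2,g1(M1,M2),g2(M2)) ∈ B_{α,γ,δ}) ≥ 1 − ε`. -/
theorem stmt17_belief_control
    {U V1 V2 W1 W2 : Type*} [Fintype U] [Fintype V1] [Fintype V2]
    [Fintype W1] [Fintype W2] [DecidableEq U]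
    (PU : U → ℝ) (hPU : IsDist PU) (hPUpos : ∀ u, 0 < PU u)
    (de : U → V1 → V2 → ℝ) (d1 : U → V1 → ℝ) (d2 : U → V2 → ℝ)
    (R1 R2 : ℝ) (hR1 : 0 < R1) (hR2 : 0 < R2)
    (Q : U → W1 × W2 → ℝ) (hQ : IsKernel Q)
    -- strict information constraints
    (hI2 : miOfJoint (fun p : U × W2 => ∑ w1, PU p.1 * Q p.1 (w1, p.2)) < R2)
    (hI12 : miOfJoint (fun p : U × (W1 × W2) => PU p.1 * Q p.1 p.2) < R1 + R2)
    -- singleton worst-case optimal action pair at every positive-probability pair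
    (hsing : ∀ (w1 : W1) (w2 : W2), 0 < Pw PU Q (w1, w2) →
      ∃ a : V1 × V2, Atilde PU de d1 d2 Q w1 w2 = {a}) :
    ∀ ε : ℝ, 0 < ε → ∀ α : ℝ, 0 < α → ∀ γ : ℝ, 0 < γ →
    ∃ δbar > 0, ∀ δ : ℝ, 0 < δ → δ ≤ δbar →
    ∃ nbar : ℕ, ∀ n : ℕ, nbar ≤ n →
    ∃ σ : (Fin n → U) → Msg R1 n × Msg R2 n → ℝ, IsKernel σ ∧
    ∃ (g1 : Msg R1 n × Msg R2 n → Fin n → W1) (g2 : Msg R2 n → Fin n → W2),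
      1 - ε ≤ ∑ un : Fin n → U, ∑ m1 : Msg R1 n, ∑ m2 : Msg R2 n,
        Pn PU σ un m1 m2 *
          (if inB PU Q σ α γ δ m1 m2 (g1 (m1, m2)) (g2 m2) then (1 : ℝ) else 0) := by
  intro ε hε α hα γ hγ
  refine ⟨1, one_pos, fun δ hδ _ => ?_⟩
  obtain ⟨η, hη, hK1, hK2⟩ := kl_eta hPU hQ (α ^ 2 / (2 * Real.log 2))
    (by have := Real.log_pos (one_lt_two : (1 : ℝ) < 2); positivity)
  have e2 := mi2_eq hPU hQ
  have e12 := mi12_eq hPU hQ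
  set I2 := miOfJoint (fun p : U × W2 => ∑ w1, PU p.1 * Q p.1 (w1, p.2))
  set I12 := miOfJoint (fun p : U × (W1 × W2) => PU p.1 * Q p.1 p.2)
  obtain ⟨τ, hτ, hτ2, hτ12⟩ : ∃ τ : ℝ, 0 < τ ∧ I2 + 2 * τ ≤ R2 ∧ I12 + 2 * τ ≤ R1 + R2 := by
    refine ⟨min (R2 - I2) (R1 + R2 - I12) / 2, ?_, ?_, ?_⟩
    · have : 0 < min (R2 - I2) (R1 + R2 - I12) := lt_min (by linarith) (by linarith)
      linarith
    · have := min_le_left (R2 - I2) (R1 + R2 - I12); linarith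
    · have := min_le_right (R2 - I2) (R1 + R2 - I12); linarith
  have hlim := tot_lim (U := U) R1 R2 I12 I2 τ hR1 hτ hτ12 hτ2
    (Ex (qT (Pw2 PU Q) (kk PU Q) (vv PU Q))
        (fun z => Real.logb 2 (vv PU Q (z.2.1, z.1) z.2.2 / PU z.2.2) ^ 2))
    (Ex (qT (Pw2 PU Q) (kk PU Q) (vv PU Q))
        (fun z => Real.logb 2 (vv2 PU Q z.1 z.2.2 / PU z.2.2) ^ 2))
    (γ * η)⁻¹ δ (Fintype.card U) (fun w1 w2 => Ex (qT (Pw2 PU Q) (kk PU Q) (vv PU Q)) (fun z =>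
      (if z.2.1 = w1 ∧ z.1 = w2 then (1 : ℝ) else 0) ^ 2))
  obtain ⟨N, hN⟩ := Filter.eventually_atTop.1 ((hlim.eventually_lt_const hε).and
    (Filter.eventually_gt_atTop 0))
  refine ⟨N, fun n hn => ?_⟩
  obtain ⟨hlt, hn0⟩ := hN n hn
  have hD := D_bound (M1 := Msg R1 n) (M2 := Msg R2 n) (Pw2_dist hPU hQ) (kk_dist hPU hQ)
    (vv_dist hPU hQ) (vv2 PU Q) (fun _ _ => rfl) PU hPU hPUpos (PU_eq hPU hQ) I12 I2 τ hτ e12 e2 hn0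
  have hF := freq_bound (Pw2_dist hPU hQ) (kk_dist hPU hQ)
    (vv_dist hPU hQ) (Pw PU Q) (Pw_eq hPU hQ) δ hδ hn0
  obtain ⟨σ, hσ, g1, g2, h⟩ := core (M1 := Msg R1 n) (M2 := Msg R2 n) (Pw2_dist hPU hQ)
    (kk_dist hPU hQ) (vv_dist hPU hQ) (vv2 PU Q) (vv2_dist hPU hQ) (fun _ _ => rfl) PU hPU Q
    α γ δ η hγ hη hK1 hK2 hn0 _ _ hD hF
  exact ⟨σ, hσ, g1, g2, le_trans (by linarith) h⟩

end Persuasion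
end
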